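/- Let N be a natural number with 1 ≤ N ≤ 3, let a, b, μ₁, μ₂ > 0 be constants, and let β > max{μ₁, μ₂} · max{a/b, b/a}. Then there exist twice continuously differentiable functions u, v : ℝ^N → ℝ such that u(x) > 0 and v(x) > 0 for all x, u and v are radially symmetric (their values depend only on |x|), the equations −Δu(x) + a·u(x) = μ₁·u(x)³ + β·u(x)·v(x)² and −Δv(x) + b·v(x) = μ₂·v(x)³ + β·v(x)·u(x)² hold pointwise on ℝ^N, u(x) → 0 and v(x) → 0 as |x| → ∞, and moreover there exist constants C, c > 0 with u(x) + v(x) ≤ C·e^{−c·|x|} for all x ∈ ℝ^N. -/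

import Mathlib

/-- The Euclidean Laplacian on `ℝ^N`: the sum of the second partial
derivatives in the coordinate directions. -/
noncomputable def laplacian (N : ℕ) (f : EuclideanSpace ℝ (Fin N) → ℝ)
    (x : EuclideanSpace ℝ (Fin N)) : ℝ :=
  ∑ i : Fin N, fderiv ℝ (fun y => fderiv ℝ f y (EuclideanSpace.single i 1)) x
    (EuclideanSpace.single i 1)

namespace RadialNLS

open MeasureTheory Set Filter Topology

/-- The radial measure `r ^ k dr` on the half-line. -/
noncomputable def wm (k : ℕ) : Measure ℝ :=
  (volume.restrict (Ioi 0)).withDensity (fun r => ENNReal.ofReal (r ^ k))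

/-- The decreasing function vanishing at infinity with derivative `-p`. -/
noncomputable def tail (p : ℝ → ℝ) (r : ℝ) : ℝ := ∫ s in Ioi r, p s

lemma measurable_density (k : ℕ) : Measurable (fun r : ℝ => ENNReal.ofReal (r ^ k)) := by
  fun_prop

lemma ae_wm {k : ℕ} {P : ℝ → Prop} :
    (∀ᵐ r ∂wm k, P r) ↔ ∀ᵐ r ∂(volume.restrict (Ioi (0 : ℝ))), P r := by
  unfold wm
  rw [ae_withDensity_iff (measurable_density k)]
  constructor <;> intro h
  · filter_upwards [h, ae_restrict_mem measurableSet_Ioi] with r hr hr0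
    apply hr
    have : 0 < r ^ k := pow_pos hr0 k
    simpa using this
  · filter_upwards [h] with r hr _ using hr

lemma ae_wm_of_pos {k : ℕ} {P : ℝ → Prop} (h : ∀ r, 0 < r → P r) : ∀ᵐ r ∂wm k, P r :=
  ae_wm.2 ((ae_restrict_mem measurableSet_Ioi).mono h)

lemma integrable_wm {k : ℕ} {f : ℝ → ℝ} :
    Integrable f (wm k) ↔ IntegrableOn (fun r => r ^ k * f r) (Ioi 0) := by
  unfold wm
  rw [integrable_withDensity_iff_integrable_smul' (measurable_density k)
    (ae_of_all _ fun _ => ENNReal.ofReal_lt_top)]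
  refine integrable_congr ?_
  filter_upwards [ae_restrict_mem measurableSet_Ioi] with r hr
  have : 0 ≤ r ^ k := (pow_pos hr k).le
  simp [ENNReal.toReal_ofReal this]

lemma integral_wm {k : ℕ} (f : ℝ → ℝ) :
    ∫ r, f r ∂wm k = ∫ r in Ioi 0, r ^ k * f r := by
  unfold wm
  rw [integral_withDensity_eq_integral_toReal_smul (measurable_density k)
    (ae_of_all _ fun _ => ENNReal.ofReal_lt_top)]
  refine integral_congr_ae ?_
  filter_upwards [ae_restrict_mem measurableSet_Ioi] with r hr
  have : 0 ≤ r ^ k := (pow_pos hr k).le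
  simp [ENNReal.toReal_ofReal this]

instance (k : ℕ) : SigmaFinite (wm k) := by
  unfold wm
  exact SigmaFinite.withDensity_of_ne_top (ae_of_all _ fun _ => ENNReal.ofReal_ne_top)

/-- Profiles `p = -u'` of nonnegative decreasing radial functions `u` of finite energy. -/
structure Adm (k : ℕ) (p : ℝ → ℝ) : Prop where
  meas : Measurable p
  nonneg : ∀ s, 0 ≤ p s
  sq_int : Integrable (fun s => p s ^ 2) (wm k)
  int_Ioi : ∀ r, 0 < r → IntegrableOn p (Ioi r)
  tail_sq_int : Integrable (fun s => tail p s ^ 2) (wm k)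

lemma tail_nonneg {p : ℝ → ℝ} (hp : ∀ s, 0 ≤ p s) (r : ℝ) : 0 ≤ tail p r :=
  integral_nonneg fun s => hp s

lemma measurable_tail {p : ℝ → ℝ} (hp : ∀ s, 0 ≤ p s) (hm : Measurable p) :
    Measurable (tail p) := by
  have : tail p = fun r => (∫⁻ s in Ioi r, ENNReal.ofReal (p s)).toReal := by
    funext r
    exact integral_eq_lintegral_of_nonneg_ae (ae_of_all _ hp) hm.aestronglyMeasurable
  rw [this]
  refine Measurable.ennreal_toReal (Antitone.measurable ?_)
  intro r s hrs
  exact lintegral_mono_set (Ioi_subset_Ioi hrs)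

namespace Adm

variable {k : ℕ} {p q : ℝ → ℝ}

lemma tail_nonneg (hp : Adm k p) (r : ℝ) : 0 ≤ tail p r := RadialNLS.tail_nonneg hp.nonneg r

lemma measurable_tail (hp : Adm k p) : Measurable (tail p) :=
  RadialNLS.measurable_tail hp.nonneg hp.meas

lemma tail_sub (hp : Adm k p) {r s : ℝ} (hr : 0 < r) (hrs : r ≤ s) :
    tail p r - tail p s = ∫ t in r..s, p t :=
  intervalIntegral.integral_Ioi_sub_Ioi (hp.int_Ioi r hr) hrs

lemma tail_anti (hp : Adm k p) {r s : ℝ} (hr : 0 < r) (hrs : r ≤ s) : tail p s ≤ tail p r := by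
  have h := hp.tail_sub hr hrs
  have : 0 ≤ ∫ t in r..s, p t := intervalIntegral.integral_nonneg hrs fun t _ => hp.nonneg t
  linarith

lemma tail_add (hp : Adm k p) (hq : Adm k q) {r : ℝ} (hr : 0 < r) :
    tail (fun s => p s + q s) r = tail p r + tail q r :=
  integral_add (hp.int_Ioi r hr) (hq.int_Ioi r hr)

lemma memLp (hp : Adm k p) : MemLp p 2 (wm k) :=
  (memLp_two_iff_integrable_sq hp.meas.aestronglyMeasurable).2 hp.sq_int

lemma tail_memLp (hp : Adm k p) : MemLp (tail p) 2 (wm k) :=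
  (memLp_two_iff_integrable_sq hp.measurable_tail.aestronglyMeasurable).2 hp.tail_sq_int

lemma smul (hp : Adm k p) {t : ℝ} (ht : 0 ≤ t) : Adm k (fun s => t * p s) where
  meas := hp.meas.const_mul t
  nonneg s := mul_nonneg ht (hp.nonneg s)
  sq_int := by simpa only [mul_pow] using hp.sq_int.const_mul (t ^ 2)
  int_Ioi r hr := (hp.int_Ioi r hr).const_mul t
  tail_sq_int := by
    have : tail (fun s => t * p s) = fun r => t * tail p r := by
      funext r; exact integral_const_mul t p
    simpa only [this, mul_pow] using hp.tail_sq_int.const_mul (t ^ 2)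

lemma add (hp : Adm k p) (hq : Adm k q) : Adm k (fun s => p s + q s) where
  meas := hp.meas.add hq.meas
  nonneg s := add_nonneg (hp.nonneg s) (hq.nonneg s)
  sq_int := (hp.memLp.add hq.memLp).integrable_sq
  int_Ioi r hr := (hp.int_Ioi r hr).add (hq.int_Ioi r hr)
  tail_sq_int := by
    refine (hp.tail_memLp.add hq.tail_memLp).integrable_sq.congr (ae_wm_of_pos fun r hr => ?_)
    simp [hp.tail_add hq hr]

end Adm

lemma tail_mul (t : ℝ) (p : ℝ → ℝ) : tail (fun s => t * p s) = fun r => t * tail p r := by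
  funext r; exact integral_const_mul t p

/-- Bounded profiles supported in a compact subinterval of the open half-line are admissible. -/
lemma adm_of_bounded {k : ℕ} {p : ℝ → ℝ} (hm : Measurable p) (h0 : ∀ s, 0 ≤ p s) {d R C : ℝ}
    (hs : ∀ s, s ∉ Icc d R → p s = 0) (hC : ∀ s, p s ≤ C) : Adm k p := by
  have hC0 : 0 ≤ C := (h0 0).trans (hC 0)
  have hint : Integrable p := by
    have : p = (Icc d R).indicator p := by
      funext s; by_cases h : s ∈ Icc d R <;> simp [h, hs]
    rw [this, integrable_indicator_iff measurableSet_Icc]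
    refine Measure.integrableOn_of_bounded (M := C) measure_Icc_lt_top.ne hm.aestronglyMeasurable
      (ae_of_all _ fun s => ?_)
    rw [Real.norm_of_nonneg (h0 s)]; exact hC s
  have key : ∀ f : ℝ → ℝ, Measurable f → (∀ s, R < s → f s = 0) → ∀ M, (∀ s, |f s| ≤ M) →
      Integrable f (wm k) := by
    intro f hf hfs M hM
    rw [integrable_wm]
    have : IntegrableOn (fun r => r ^ k * f r) (Ioc 0 R) := by
      refine Measure.integrableOn_of_bounded (M := R ^ k * M) measure_Ioc_lt_top.ne
        (by fun_prop) ?_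
      filter_upwards [ae_restrict_mem measurableSet_Ioc] with r hr
      rw [norm_mul, norm_pow, Real.norm_of_nonneg hr.1.le]
      gcongr
      · exact pow_nonneg (hr.1.le.trans hr.2) k
      · exact hr.1.le
      · exact hr.2
      · exact hM r
    refine (this.integrable_indicator measurableSet_Ioc).integrableOn.congr ?_
    filter_upwards [ae_restrict_mem measurableSet_Ioi] with r hr
    by_cases h : r ∈ Ioc 0 R
    · simp [h]
    · have : R < r := by
        by_contra! h'; exact h ⟨hr, h'⟩
      simp [h, hfs r this]
  have htR : ∀ s, R < s → tail p s = 0 := fun s hs' => by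
    refine setIntegral_eq_zero_of_forall_eq_zero fun t ht => ?_
    exact hs t fun h => absurd (h.2.trans hs'.le) (not_le.2 ht)
  have htb : ∀ s, tail p s ≤ ∫ t, p t := fun s =>
    setIntegral_le_integral hint (ae_of_all _ h0)
  refine ⟨hm, h0, ?_, fun r _ => hint.integrableOn, ?_⟩
  · refine key _ (hm.pow_const 2) (fun s hs' => ?_) (C ^ 2) fun s => ?_
    · rw [hs s fun h => absurd h.2 (not_le.2 hs')]; simp
    · rw [abs_pow, abs_of_nonneg (h0 s)]; exact pow_le_pow_left₀ (h0 s) (hC s) 2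
  · refine key _ ((measurable_tail h0 hm).pow_const 2) (fun s hs' => ?_) ((∫ t, p t) ^ 2)
      fun s => ?_
    · rw [htR s hs']; simp
    · rw [abs_pow, abs_of_nonneg (tail_nonneg h0 s)]
      exact pow_le_pow_left₀ (tail_nonneg h0 s) (htb s) 2

lemma integral_pow_Ioc (k : ℕ) {r : ℝ} (hr : 0 < r) :
    ∫ s in Ioc 0 r, s ^ k = r ^ (k + 1) / (k + 1) := by
  rw [← intervalIntegral.integral_of_le hr.le, integral_pow]; simp

namespace Adm
variable {k : ℕ} {p q : ℝ → ℝ}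

lemma tail_sq_mul_pow_le (hp : Adm k p) {r : ℝ} (hr : 0 < r) :
    tail p r ^ 2 * r ^ (k + 1) ≤ (k + 1) * ∫ s, tail p s ^ 2 ∂wm k := by
  have h1 : ∫ s in Ioc 0 r, s ^ k * tail p r ^ 2 ≤ ∫ s, tail p s ^ 2 ∂wm k := by
    rw [integral_wm]
    have hi := integrable_wm.1 hp.tail_sq_int
    calc ∫ s in Ioc 0 r, s ^ k * tail p r ^ 2 ≤ ∫ s in Ioc 0 r, s ^ k * tail p s ^ 2 := by
          refine setIntegral_mono_on ?_ (hi.mono_set Ioc_subset_Ioi_self) measurableSet_Ioc ?_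
          · exact (Continuous.integrableOn_Icc (by fun_prop)).mono_set Ioc_subset_Icc_self
          · intro s hs
            have := hp.tail_anti hs.1 hs.2
            have h3 := hp.tail_nonneg r
            have h4 : 0 < s ^ k := pow_pos hs.1 k
            gcongr
      _ ≤ _ := by
          refine setIntegral_mono_set hi ?_ (ae_of_all _ fun s hs => Ioc_subset_Ioi_self hs)
          filter_upwards [ae_restrict_mem measurableSet_Ioi] with s hs
          exact mul_nonneg (pow_nonneg (le_of_lt hs) k) (sq_nonneg _)
  rw [integral_mul_const, integral_pow_Ioc k hr] at h1
  have hk : (0 : ℝ) < k + 1 := by positivity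
  calc tail p r ^ 2 * r ^ (k + 1) = (k + 1) * (r ^ (k + 1) / (k + 1) * tail p r ^ 2) := by
        field_simp
    _ ≤ _ := by gcongr

end Adm

/-- In dimension at most three the fundamental solution grows at most like `r⁻¹`. -/
lemma sqrt_mul_integral_inv_pow_le {k : ℕ} (hk : k ≤ 2) {r : ℝ} (hr : 0 < r) (hr1 : r ≤ 1) :
    √(r ^ k) * ∫ s in r..1, (s ^ k)⁻¹ ≤ 2 := by
  interval_cases k
  · simp; linarith
  · have h0 : (0 : ℝ) ∉ uIcc r 1 := by
      rw [uIcc_of_le hr1]; intro h; exact absurd h.1 (not_le.2 hr)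
    simp only [pow_one]
    rw [integral_inv h0, one_div, Real.log_inv]
    have hs : 0 < √r := Real.sqrt_pos.2 hr
    have h1 : -Real.log r = 2 * Real.log (√r)⁻¹ := by
      rw [Real.log_inv, Real.log_sqrt hr.le]; ring
    have h2 := Real.log_le_sub_one_of_pos (inv_pos.2 hs)
    rw [h1]
    calc √r * (2 * Real.log (√r)⁻¹) ≤ √r * (2 * ((√r)⁻¹ - 1)) := by gcongr
      _ = 2 - 2 * √r := by field_simp
      _ ≤ 2 := by linarith
  · have h0 : (0 : ℝ) ∉ uIcc r 1 := by
      rw [uIcc_of_le hr1]; intro h; exact absurd h.1 (not_le.2 hr)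
    have h1 : ∫ s in r..1, (s ^ 2)⁻¹ = r⁻¹ - 1 := by
      have : ∀ s : ℝ, (s ^ 2)⁻¹ = s ^ (-2 : ℤ) := fun s => by
        rw [zpow_neg]; norm_cast
      simp_rw [this]
      rw [integral_zpow (Or.inr ⟨by norm_num, h0⟩)]
      norm_num
      ring
    rw [h1, Real.sqrt_sq hr.le]
    have : r * (r⁻¹ - 1) = 1 - r := by field_simp
    linarith

namespace Adm
variable {k : ℕ} {p q : ℝ → ℝ}

/-- A quarter power of `r ^ k` compensates the singularity of the tail at the origin. -/
lemma sqrt_sqrt_mul_tail_le (hp : Adm k p) (hk : k ≤ 2) {A D : ℝ}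
    (hA : ∫ s, p s ^ 2 ∂wm k ≤ A) (hD : ∫ s, tail p s ^ 2 ∂wm k ≤ D) {r : ℝ} (hr : 0 < r)
    (hr1 : r ≤ 1) : √√(r ^ k) * tail p r ≤ 3 * D + A + 2 := by
  have hrk : 0 < r ^ k := pow_pos hr k
  set e := √√(r ^ k) with he
  have he0 : 0 < e := Real.sqrt_pos.2 (Real.sqrt_pos.2 hrk)
  have he1 : e ≤ 1 := by
    rw [he, Real.sqrt_le_one, Real.sqrt_le_one]; exact pow_le_one₀ hr.le hr1
  have he2 : e ^ 2 = √(r ^ k) := Real.sq_sqrt (Real.sqrt_nonneg _)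
  have hpi : IntervalIntegrable p volume r 1 := by
    rw [intervalIntegrable_iff_integrableOn_Ioc_of_le hr1]
    exact (hp.int_Ioi r hr).mono_set Ioc_subset_Ioi_self
  have hwi : IntervalIntegrable (fun s => s ^ k * p s ^ 2) volume r 1 := by
    rw [intervalIntegrable_iff_integrableOn_Ioc_of_le hr1]
    exact (integrable_wm.1 hp.sq_int).mono_set
      (Ioc_subset_Ioi_self.trans (Ioi_subset_Ioi hr.le))
  have hii : IntervalIntegrable (fun s : ℝ => (s ^ k)⁻¹) volume r 1 := by
    refine ContinuousOn.intervalIntegrable ?_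
    rw [uIcc_of_le hr1]
    refine (by fun_prop : ContinuousOn (fun s : ℝ => s ^ k) (Icc r 1)).inv₀ fun s hs => ?_
    exact (pow_pos (hr.trans_le hs.1) k).ne'
  have hW : ∫ s in r..1, s ^ k * p s ^ 2 ≤ A := by
    refine le_trans ?_ hA
    rw [integral_wm, intervalIntegral.integral_of_le hr1]
    refine setIntegral_mono_set (integrable_wm.1 hp.sq_int) ?_
      (ae_of_all _ fun s hs => hr.trans hs.1)
    filter_upwards [ae_restrict_mem measurableSet_Ioi] with s hs
    exact mul_nonneg (pow_nonneg (le_of_lt hs) k) (sq_nonneg _)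
  have hL := sqrt_mul_integral_inv_pow_le hk hr hr1
  have hmain : ∫ s in r..1, e * p s ≤
      ∫ s in r..1, (s ^ k * p s ^ 2 + e ^ 2 * (s ^ k)⁻¹) / 2 := by
    refine intervalIntegral.integral_mono_on hr1 (hpi.const_mul e)
      ((hwi.add (hii.const_mul _)).div_const 2) fun s hs => ?_
    have hs0 : 0 < s ^ k := pow_pos (hr.trans_le hs.1) k
    have : 0 ≤ (s ^ k * p s - e) ^ 2 / s ^ k := by positivity
    have h2 : (s ^ k * p s - e) ^ 2 / s ^ k =
      s ^ k * p s ^ 2 + e ^ 2 * (s ^ k)⁻¹ - 2 * (e * p s) := by field_simp; ring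
    linarith
  rw [intervalIntegral.integral_const_mul, intervalIntegral.integral_div,
    intervalIntegral.integral_add hwi (hii.const_mul _), intervalIntegral.integral_const_mul,
    he2] at hmain
  have h1 := hp.tail_sub hr hr1
  have h2 := hp.tail_sq_mul_pow_le one_pos
  have hk' : (k : ℝ) ≤ 2 := by exact_mod_cast hk
  have hD0 : 0 ≤ ∫ s, tail p s ^ 2 ∂wm k := integral_nonneg fun s => sq_nonneg _
  have hA0 : 0 ≤ ∫ s, p s ^ 2 ∂wm k := integral_nonneg fun s => sq_nonneg _
  have h3 : tail p 1 ^ 2 ≤ 3 * D := by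
    simp only [one_pow, mul_one] at h2
    nlinarith
  have h4 : tail p 1 ≤ 3 * D + 1 := by nlinarith [sq_nonneg (tail p 1 - 1)]
  have h5 : e * tail p r = e * tail p 1 + e * ∫ s in r..1, p s := by rw [← h1]; ring
  have h6 : e * tail p 1 ≤ tail p 1 := mul_le_of_le_one_left (hp.tail_nonneg 1) he1
  rw [h5]
  linarith

lemma pow_mul_tail_four_le (hp : Adm k p) (hk : k ≤ 2) {A D : ℝ}
    (hA : ∫ s, p s ^ 2 ∂wm k ≤ A) (hD : ∫ s, tail p s ^ 2 ∂wm k ≤ D) {r : ℝ} (hr : 0 < r) :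
    r ^ k * tail p r ^ 4 ≤ 2 * (3 * D + A + 2) ^ 4 * (1 + r ^ 2)⁻¹ := by
  have hrk : 0 < r ^ k := pow_pos hr k
  have hD0 : 0 ≤ ∫ s, tail p s ^ 2 ∂wm k := integral_nonneg fun s => sq_nonneg _
  have hA0 : 0 ≤ ∫ s, p s ^ 2 ∂wm k := integral_nonneg fun s => sq_nonneg _
  have hK1 : 1 ≤ 3 * D + A + 2 := by linarith
  rw [← div_eq_mul_inv, le_div_iff₀ (by positivity)]
  rcases le_total r 1 with h | h
  · have h1 := hp.sqrt_sqrt_mul_tail_le hk hA hD hr h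
    have h2 : (√√(r ^ k) * tail p r) ^ 4 ≤ (3 * D + A + 2) ^ 4 :=
      pow_le_pow_left₀ (mul_nonneg (Real.sqrt_nonneg _) (hp.tail_nonneg r)) h1 4
    have h3 : √√(r ^ k) ^ 4 = r ^ k := by
      rw [show (4 : ℕ) = 2 * 2 by norm_num, pow_mul, Real.sq_sqrt (Real.sqrt_nonneg _),
        Real.sq_sqrt hrk.le]
    rw [mul_pow, h3] at h2
    have h4 : 0 ≤ r ^ k * tail p r ^ 4 := by positivity
    have h5 : r ^ 2 ≤ 1 := pow_le_one₀ hr.le h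
    nlinarith
  · have h1 := hp.tail_sq_mul_pow_le hr
    have hk' : (k : ℝ) ≤ 2 := by exact_mod_cast hk
    have h2 : tail p r ^ 2 * r ^ (k + 1) ≤ 3 * D + A + 2 := by nlinarith
    have h3 : (tail p r ^ 2 * r ^ (k + 1)) ^ 2 ≤ (3 * D + A + 2) ^ 2 :=
      pow_le_pow_left₀ (by positivity) h2 2
    have h4 : (3 * D + A + 2) ^ 2 ≤ (3 * D + A + 2) ^ 4 :=
      pow_le_pow_right₀ hK1 (by norm_num)
    have h5 : r ^ k * tail p r ^ 4 * r ^ 2 ≤ (tail p r ^ 2 * r ^ (k + 1)) ^ 2 := by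
      have : (tail p r ^ 2 * r ^ (k + 1)) ^ 2 = r ^ k * tail p r ^ 4 * r ^ 2 * r ^ k := by ring
      rw [this]
      exact le_mul_of_one_le_right (by positivity) (one_le_pow₀ h)
    have h6 : 0 ≤ r ^ k * tail p r ^ 4 := by positivity
    have h7 : 1 ≤ r ^ 2 := one_le_pow₀ h
    nlinarith

lemma tail_four_int (hp : Adm k p) (hk : k ≤ 2) : Integrable (fun r => tail p r ^ 4) (wm k) := by
  rw [integrable_wm]
  refine Integrable.mono' ((integrable_inv_one_add_sq.const_mul
    (2 * (3 * (∫ s, tail p s ^ 2 ∂wm k) + (∫ s, p s ^ 2 ∂wm k) + 2) ^ 4)).integrableOn)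
    (((measurable_id.pow_const k).mul (hp.measurable_tail.pow_const 4)).aestronglyMeasurable) ?_
  filter_upwards [ae_restrict_mem measurableSet_Ioi] with r hr
  have h0 : 0 ≤ r ^ k * tail p r ^ 4 := mul_nonneg (pow_nonneg (le_of_lt hr) k) (by positivity)
  rw [Real.norm_of_nonneg h0]
  exact hp.pow_mul_tail_four_le hk le_rfl le_rfl hr

end Adm

lemma integrable_and_integral_le_of_tendsto {μ : Measure ℝ} {G : ℕ → ℝ → ℝ} {f : ℝ → ℝ} {C : ℝ}
    (hGf : ∀ᵐ x ∂μ, Tendsto (fun n => G n x) atTop (𝓝 (f x)))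
    (hGi : ∀ n, Integrable (G n) μ) (h0 : ∀ n x, 0 ≤ G n x)
    (hC : ∀ᶠ n in atTop, ∫ x, G n x ∂μ ≤ C) : Integrable f μ ∧ ∫ x, f x ∂μ ≤ C := by
  have hG : ∀ n, ∫⁻ x, ‖G n x‖ₑ ∂μ = ENNReal.ofReal (∫ x, G n x ∂μ) := fun n => by
    rw [← ofReal_integral_norm_eq_lintegral_enorm (hGi n)]
    simp only [Real.norm_of_nonneg (h0 n _)]
  have hlim : liminf (fun n => ∫⁻ x, ‖G n x‖ₑ ∂μ) atTop ≤ ENNReal.ofReal C := by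
    refine liminf_le_of_frequently_le' (hC.frequently.mono fun n hn => ?_)
    rw [hG n]; exact ENNReal.ofReal_le_ofReal hn
  have hfi : Integrable f μ :=
    integrable_of_tendsto hGf (fun n => (hGi n).aestronglyMeasurable)
      (hlim.trans_lt ENNReal.ofReal_lt_top).ne
  have hf0 : 0 ≤ᵐ[μ] f := by
    filter_upwards [hGf] with x hx using ge_of_tendsto' hx fun n => h0 n x
  refine ⟨hfi, ?_⟩
  obtain ⟨n, hn⟩ := hC.exists
  have hC0 : 0 ≤ C := (integral_nonneg (h0 n)).trans hn
  have h1 := (lintegral_enorm_le_liminf_of_tendsto hGf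
    fun n => (hGi n).aestronglyMeasurable.enorm).trans hlim
  rw [← ofReal_integral_norm_eq_lintegral_enorm hfi, ENNReal.ofReal_le_ofReal_iff hC0] at h1
  refine le_trans (le_of_eq (integral_congr_ae ?_)) h1
  filter_upwards [hf0] with x hx using (Real.norm_of_nonneg hx).symm

/-- Weak sequential compactness for bounded sequences of nonnegative functions in `L²`. -/
lemma exists_weak_limit {k : ℕ} {P : ℕ → ℝ → ℝ} {A : ℝ} (hP : ∀ n, MemLp (P n) 2 (wm k))
    (h0 : ∀ n s, 0 ≤ P n s) (hA : ∀ n, ∫ s, P n s ^ 2 ∂wm k ≤ A) :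
    ∃ p : ℝ → ℝ, Measurable p ∧ (∀ s, 0 ≤ p s) ∧ MemLp p 2 (wm k) ∧
      ∃ φ : ℕ → ℕ, StrictMono φ ∧ ∀ g : ℝ → ℝ, MemLp g 2 (wm k) →
        Tendsto (fun n => ∫ s, P (φ n) s * g s ∂wm k) atTop (𝓝 (∫ s, p s * g s ∂wm k)) := by
  let X : ℕ → Lp ℝ 2 (wm k) := fun n => (hP n).toLp (P n)
  have hin : ∀ {f g : ℝ → ℝ} (hf : MemLp f 2 (wm k)) (hg : MemLp g 2 (wm k)),
      inner ℝ (hf.toLp f) (hg.toLp g) = ∫ s, f s * g s ∂wm k := by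
    intro f g hf hg
    rw [L2.inner_def]
    refine integral_congr_ae ?_
    filter_upwards [hf.coeFn_toLp, hg.coeFn_toLp] with s h1 h2
    rw [h1, h2]; simp [mul_comm]
  have hXn : ∀ n, ‖X n‖ ≤ √A := fun n => by
    refine Real.le_sqrt_of_sq_le ?_
    rw [← real_inner_self_eq_norm_sq, hin]
    simpa only [pow_two] using hA n
  have hmem : ∀ n, (StrongDual.toWeakDual (InnerProductSpace.toDual ℝ _ (X n))) ∈
      WeakDual.toStrongDual ⁻¹' Metric.closedBall (0 : StrongDual ℝ (Lp ℝ 2 (wm k))) (√A) := by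
    intro n
    simp only [mem_preimage, mem_closedBall_zero_iff]
    refine le_trans (le_of_eq ?_) (hXn n)
    exact (InnerProductSpace.toDual ℝ _).norm_map (X n)
  have : Fact ((2 : ENNReal) ≠ ⊤) := ⟨by norm_num⟩
  obtain ⟨L, _, φ, hφ, hL⟩ := WeakDual.isSeqCompact_closedBall ℝ _ 0 (√A) hmem
  let Y : Lp ℝ 2 (wm k) := (InnerProductSpace.toDual ℝ _).symm (WeakDual.toStrongDual L)
  have hY : ∀ Z, Tendsto (fun n => inner ℝ (X (φ n)) Z) atTop (𝓝 (inner ℝ Y Z)) := by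
    intro Z
    have h1 := (tendsto_iff_forall_eval_tendsto_topDualPairing).1 hL Z
    have h2 : inner ℝ Y Z = L Z := InnerProductSpace.toDual_symm_apply
    rw [h2]
    exact h1
  have hYm := Lp.memLp Y
  have hneg : MemLp (fun s => max (-(Y s)) 0) 2 (wm k) := hYm.neg.pos_part
  have hYlim : ∀ g : ℝ → ℝ, MemLp g 2 (wm k) →
      Tendsto (fun n => ∫ s, P (φ n) s * g s ∂wm k) atTop (𝓝 (∫ s, Y s * g s ∂wm k)) := by
    intro g hg
    have h1 := hY (hg.toLp g)
    have h2 : inner ℝ Y (hg.toLp g) = ∫ s, Y s * g s ∂wm k := by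
      rw [← hin hYm hg, Lp.toLp_coeFn]
    rw [h2] at h1
    simpa only [X, hin] using h1
  have hY0 : 0 ≤ᵐ[wm k] Y := by
    have h1 : 0 ≤ ∫ s, Y s * max (-(Y s)) 0 ∂wm k :=
      ge_of_tendsto' (hYlim _ hneg) fun n =>
        integral_nonneg fun s => mul_nonneg (h0 _ s) (le_max_right _ _)
    have h2 : ∀ s, Y s * max (-(Y s)) 0 = -(max (-(Y s)) 0) ^ 2 := fun s => by
      rcases max_cases (-(Y s)) 0 with h | h <;> rw [h.1] <;> ring
    simp_rw [h2, integral_neg] at h1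
    have h3 : ∫ s, (max (-(Y s)) 0) ^ 2 ∂wm k = 0 :=
      le_antisymm (by linarith) (integral_nonneg fun s => sq_nonneg _)
    rw [integral_eq_zero_iff_of_nonneg (fun s => sq_nonneg _) hneg.integrable_sq] at h3
    filter_upwards [h3] with s hs
    have : max (-(Y s)) 0 = 0 := by simpa using hs
    have := le_max_left (-(Y s)) 0
    simp only [Pi.zero_apply]
    linarith
  have hsm : Measurable (Y : ℝ → ℝ) := (Lp.stronglyMeasurable Y).measurable
  have hpY : (fun s => max (Y s) 0) =ᵐ[wm k] Y := by
    filter_upwards [hY0] with s hs using max_eq_left hs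
  refine ⟨fun s => max (Y s) 0, hsm.max measurable_const, fun s => le_max_right _ _,
    hYm.pos_part, φ, hφ, fun g hg => ?_⟩
  have : ∫ s, max (Y s) 0 * g s ∂wm k = ∫ s, Y s * g s ∂wm k := by
    refine integral_congr_ae ?_
    filter_upwards [hpY] with s hs
    rw [hs]
  rw [this]
  exact hYlim g hg

lemma integral_Ioc_eq_wm {k : ℕ} (f : ℝ → ℝ) {r s : ℝ} (hr : 0 < r) :
    ∫ t in Ioc r s, f t = ∫ t, f t * (Ioc r s).indicator (fun t => (t ^ k)⁻¹) t ∂wm k := by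
  rw [integral_wm, ← integral_indicator measurableSet_Ioc, ← integral_indicator measurableSet_Ioi]
  congr 1
  funext t
  by_cases h : t ∈ Ioc r s
  · have ht : 0 < t := hr.trans h.1
    have : t ^ k ≠ 0 := (pow_pos ht k).ne'
    simp only [h, indicator_of_mem, mem_Ioi, ht]
    field_simp
  · simp [h, indicator]

lemma memLp_indicator_inv {k : ℕ} {r s : ℝ} (hr : 0 < r) :
    MemLp ((Ioc r s).indicator (fun t : ℝ => (t ^ k)⁻¹)) 2 (wm k) := by
  have hm : Measurable ((Ioc r s).indicator (fun t : ℝ => (t ^ k)⁻¹)) :=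
    ((measurable_id.pow_const k).inv).indicator measurableSet_Ioc
  rw [memLp_two_iff_integrable_sq hm.aestronglyMeasurable, integrable_wm]
  have h1 : IntegrableOn (fun t : ℝ => (t ^ k)⁻¹) (Ioc r s) := by
    refine (ContinuousOn.integrableOn_Icc ?_).mono_set Ioc_subset_Icc_self
    refine (by fun_prop : ContinuousOn (fun s : ℝ => s ^ k) (Icc r s)).inv₀ fun t ht => ?_
    exact (pow_pos (hr.trans_le ht.1) k).ne'
  refine ((h1.integrable_indicator measurableSet_Ioc).integrableOn).congr (ae_of_all _ fun t => ?_)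
  by_cases h : t ∈ Ioc r s
  · have : t ^ k ≠ 0 := (pow_pos (hr.trans h.1) k).ne'
    simp only [h, indicator_of_mem]
    field_simp
  · simp [h]

/-- A sequence of admissible profiles of bounded energy converges along a subsequence: the profiles
weakly, their tails pointwise. -/
lemma exists_adm_limit {k : ℕ} {P : ℕ → ℝ → ℝ} {A D : ℝ} (hP : ∀ n, Adm k (P n))
    (hA : ∀ n, ∫ s, P n s ^ 2 ∂wm k ≤ A) (hD : ∀ n, ∫ s, tail (P n) s ^ 2 ∂wm k ≤ D) :
    ∃ p : ℝ → ℝ, Adm k p ∧ ∃ φ : ℕ → ℕ, StrictMono φ ∧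
      (∀ r, 0 < r → Tendsto (fun n => tail (P (φ n)) r) atTop (𝓝 (tail p r))) ∧
      Tendsto (fun n => ∫ s, P (φ n) s * p s ∂wm k) atTop (𝓝 (∫ s, p s ^ 2 ∂wm k)) := by
  obtain ⟨p, hpm, hp0, hpL, φ, hφ, hlim⟩ :=
    exists_weak_limit (fun n => (hP n).memLp) (fun n => (hP n).nonneg) hA
  have hloc : ∀ r s, 0 < r → r ≤ s →
      Tendsto (fun n => tail (P (φ n)) r - tail (P (φ n)) s) atTop (𝓝 (∫ t in Ioc r s, p t)) := by
    intro r s hr hrs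
    have h := hlim _ (memLp_indicator_inv (s := s) hr)
    simp_rw [← integral_Ioc_eq_wm _ hr] at h
    refine h.congr fun n => ?_
    rw [(hP _).tail_sub hr hrs, intervalIntegral.integral_of_le hrs]
  have hub : ∀ n r, 0 < r → tail (P n) r ^ 2 * r ^ (k + 1) ≤ (k + 1) * D := fun n r hr =>
    ((hP n).tail_sq_mul_pow_le hr).trans (by gcongr; exact hD n)
  have hD0 : 0 ≤ (k + 1) * D := le_trans (by positivity) (hub 0 1 one_pos)
  have hub' : ∀ n r, 0 < r → tail (P n) r ≤ √((k + 1) * D / r ^ (k + 1)) := fun n r hr => by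
    refine Real.le_sqrt_of_sq_le ?_
    rw [le_div_iff₀ (by positivity)]
    exact hub n r hr
  have hploc : ∀ r s, 0 < r → IntegrableOn p (Ioc r s) := by
    intro r s hr
    have h1 : Integrable (fun t => p t * (Ioc r s).indicator (fun t => (t ^ k)⁻¹) t) (wm k) :=
      hpL.integrable_mul (memLp_indicator_inv hr)
    rw [integrable_wm] at h1
    refine (h1.mono_set (fun t (ht : t ∈ Ioc r s) => hr.trans ht.1)).congr ?_
    filter_upwards [ae_restrict_mem measurableSet_Ioc] with t ht
    have : t ^ k ≠ 0 := (pow_pos (hr.trans ht.1) k).ne'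
    simp only [ht, indicator_of_mem]
    field_simp
  have hpI : ∀ r, 0 < r → IntegrableOn p (Ioi r) := by
    intro r hr
    refine integrableOn_Ioi_of_intervalIntegral_norm_bounded (l := atTop) (b := fun s : ℝ => s)
      (√((k + 1) * D / r ^ (k + 1))) r (fun s => hploc r s hr) tendsto_id ?_
    filter_upwards [eventually_ge_atTop r] with s hs
    simp_rw [Real.norm_of_nonneg (hp0 _)]
    rw [intervalIntegral.integral_of_le hs]
    refine le_of_tendsto' (hloc r s hr hs) fun n => ?_
    have := (hP (φ n)).tail_nonneg s
    linarith [hub' (φ n) r hr]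
  have htail : ∀ r, 0 < r → Tendsto (fun n => tail (P (φ n)) r) atTop (𝓝 (tail p r)) := by
    intro r hr
    rw [Metric.tendsto_atTop]
    intro ε hε
    have hz : Tendsto (fun s : ℝ => √((k + 1) * D / s ^ (k + 1))) atTop (𝓝 0) := by
      have h1 : Tendsto (fun s : ℝ => (k + 1) * D / s ^ (k + 1)) atTop (𝓝 0) :=
        Tendsto.div_atTop tendsto_const_nhds (tendsto_pow_atTop (by omega))
      simpa using h1.sqrt
    have hz2 : Tendsto (fun s => ∫ t in r..s, p t) atTop (𝓝 (tail p r)) :=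
      intervalIntegral_tendsto_integral_Ioi r (hpI r hr) tendsto_id
    have e1 := hz.eventually (gt_mem_nhds (by positivity : 0 < ε / 3))
    have e2 := (Metric.tendsto_nhds.1 hz2) (ε / 3) (by positivity)
    obtain ⟨s, hs1, hs2, hrs⟩ := (e1.and (e2.and (eventually_ge_atTop r))).exists
    rw [intervalIntegral.integral_of_le hrs] at hs2
    obtain ⟨N, hN⟩ := (Metric.tendsto_atTop.1 (hloc r s hr hrs)) (ε / 3) (by positivity)
    refine ⟨N, fun n hn => ?_⟩
    have h3 := hN n hn
    have h4 := hub' (φ n) s (hr.trans_le hrs)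
    have h5 := (hP (φ n)).tail_nonneg s
    rw [Real.dist_eq, abs_lt] at *
    constructor <;> linarith
  have htail_ae : ∀ᵐ r ∂wm k,
      Tendsto (fun n => tail (P (φ n)) r ^ 2) atTop (𝓝 (tail p r ^ 2)) :=
    ae_wm_of_pos fun r hr => (htail r hr).pow 2
  have hfat := integrable_and_integral_le_of_tendsto htail_ae
    (fun n => (hP (φ n)).tail_sq_int) (fun n r => sq_nonneg _)
    (Eventually.of_forall fun n => hD (φ n))
  refine ⟨p, ⟨hpm, hp0, hpL.integrable_sq, hpI, hfat.1⟩, φ, hφ, htail, ?_⟩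
  simpa only [pow_two] using hlim p hpL

namespace Adm
variable {k : ℕ} {p q : ℝ → ℝ}

lemma tail_eq_zero (hp : Adm k p) (h : ∫ r, tail p r ^ 4 ∂wm k ≤ 0) (hk : k ≤ 2) {r : ℝ}
    (hr : 0 < r) : tail p r = 0 := by
  have h0 : ∫ r, tail p r ^ 4 ∂wm k = 0 := le_antisymm h (integral_nonneg fun r => by positivity)
  rw [integral_eq_zero_iff_of_nonneg (fun r => by positivity) (hp.tail_four_int hk)] at h0
  have h1 : ∫ r, tail p r ^ 2 ∂wm k = 0 := by
    refine (integral_congr_ae ?_).trans (integral_zero ℝ ℝ)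
    filter_upwards [h0] with r hr
    have : tail p r = 0 := by simpa using hr
    simp [this]
  have h2 := hp.tail_sq_mul_pow_le hr
  rw [h1, mul_zero] at h2
  have h3 : 0 < r ^ (k + 1) := by positivity
  have h4 : tail p r ^ 2 ≤ 0 := nonpos_of_mul_nonpos_left h2 h3
  exact pow_eq_zero_iff two_ne_zero |>.1 (le_antisymm h4 (sq_nonneg _))

lemma prod_four_int {p₁ p₂ p₃ p₄ : ℝ → ℝ} (hk : k ≤ 2) (h₁ : Adm k p₁) (h₂ : Adm k p₂)
    (h₃ : Adm k p₃) (h₄ : Adm k p₄) :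
    Integrable (fun r => tail p₁ r * tail p₂ r * tail p₃ r * tail p₄ r) (wm k) := by
  refine Integrable.mono' ((((h₁.tail_four_int hk).add (h₂.tail_four_int hk)).add
    (h₃.tail_four_int hk)).add (h₄.tail_four_int hk)) ?_ (ae_of_all _ fun r => ?_)
  · exact (((h₁.measurable_tail.mul h₂.measurable_tail).mul h₃.measurable_tail).mul
      h₄.measurable_tail).aestronglyMeasurable
  · have e1 := h₁.tail_nonneg r
    have e2 := h₂.tail_nonneg r
    have e3 := h₃.tail_nonneg r
    have e4 := h₄.tail_nonneg r
    rw [Real.norm_of_nonneg (by positivity)]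
    simp only [Pi.add_apply]
    nlinarith [sq_nonneg (tail p₁ r * tail p₂ r - tail p₃ r * tail p₄ r),
      sq_nonneg (tail p₁ r ^ 2 - tail p₂ r ^ 2), sq_nonneg (tail p₃ r ^ 2 - tail p₄ r ^ 2)]

end Adm

/-- The quadratic form of `-Δ + a` on radial functions, in terms of the profile. -/
noncomputable def bil (k : ℕ) (a : ℝ) (p q : ℝ → ℝ) : ℝ :=
  ∫ r, p r * q r ∂wm k + a * ∫ r, tail p r * tail q r ∂wm k

/-- The interaction integral of `u² v²`. -/
noncomputable def inter (k : ℕ) (p q : ℝ → ℝ) : ℝ := ∫ r, tail p r ^ 2 * tail q r ^ 2 ∂wm k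

/-- The quartic part of the energy. -/
noncomputable def quartic (k : ℕ) (μ₁ μ₂ β : ℝ) (p q : ℝ → ℝ) : ℝ :=
  μ₁ * inter k p p + 2 * β * inter k p q + μ₂ * inter k q q

section
variable {k : ℕ} {p q : ℝ → ℝ}

lemma inter_int (hk : k ≤ 2) (hp : Adm k p) (hq : Adm k q) :
    Integrable (fun r => tail p r ^ 2 * tail q r ^ 2) (wm k) :=
  (hp.prod_four_int hk hp hq hq).congr (ae_of_all _ fun r => by simp only; ring)

lemma inter_self (k : ℕ) (p : ℝ → ℝ) : inter k p p = ∫ r, tail p r ^ 4 ∂wm k := by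
  unfold inter; congr 1; funext r; ring

lemma inter_comm (k : ℕ) (p q : ℝ → ℝ) : inter k p q = inter k q p := by
  unfold inter; congr 1; funext r; ring

lemma quartic_comm (k : ℕ) (μ₁ μ₂ β : ℝ) (p q : ℝ → ℝ) :
    quartic k μ₁ μ₂ β p q = quartic k μ₂ μ₁ β q p := by
  unfold quartic; rw [inter_comm k p q]; ring

lemma bil_self_nonneg {a : ℝ} (ha : 0 < a) (p : ℝ → ℝ) : 0 ≤ bil k a p p :=
  add_nonneg (integral_nonneg fun _ => mul_self_nonneg _)
    (mul_nonneg ha.le (integral_nonneg fun _ => mul_self_nonneg _))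

lemma bil_nonneg {a : ℝ} (ha : 0 < a) (hp : Adm k p) (hq : Adm k q) : 0 ≤ bil k a p q :=
  add_nonneg (integral_nonneg fun r => mul_nonneg (hp.nonneg r) (hq.nonneg r))
    (mul_nonneg ha.le (integral_nonneg fun r => mul_nonneg (hp.tail_nonneg r) (hq.tail_nonneg r)))

lemma sq_le_bil {a : ℝ} (ha : 0 < a) (p : ℝ → ℝ) : ∫ r, p r ^ 2 ∂wm k ≤ bil k a p p := by
  unfold bil
  have : 0 ≤ ∫ r, tail p r * tail p r ∂wm k := integral_nonneg fun _ => mul_self_nonneg _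
  simp only [← pow_two] at *
  nlinarith

lemma tail_sq_le_bil {a : ℝ} (ha : 0 < a) (p : ℝ → ℝ) :
    ∫ r, tail p r ^ 2 ∂wm k ≤ bil k a p p / a := by
  rw [le_div_iff₀ ha]
  unfold bil
  have : 0 ≤ ∫ r, p r * p r ∂wm k := integral_nonneg fun _ => mul_self_nonneg _
  simp only [← pow_two] at *
  nlinarith

lemma bil_smul (a t : ℝ) (p : ℝ → ℝ) :
    bil k a (fun s => t * p s) (fun s => t * p s) = t ^ 2 * bil k a p p := by
  unfold bil
  have e1 : ∀ f : ℝ → ℝ, ∫ r, t * f r * (t * f r) ∂wm k = t ^ 2 * ∫ r, f r * f r ∂wm k := by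
    intro f; rw [← integral_const_mul]; congr 1; funext r; ring
  rw [tail_mul, e1, e1]; ring

lemma inter_smul (t s : ℝ) (p q : ℝ → ℝ) :
    inter k (fun r => t * p r) (fun r => s * q r) = t ^ 2 * s ^ 2 * inter k p q := by
  unfold inter
  rw [tail_mul, tail_mul, ← integral_const_mul]; congr 1; funext r; ring

lemma bil_add_smul {a t : ℝ} (ht : 0 ≤ t) (hp : Adm k p) (hq : Adm k q) :
    bil k a (fun s => p s + t * q s) (fun s => p s + t * q s) =
      bil k a p p + 2 * t * bil k a p q + t ^ 2 * bil k a q q := by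
  have e : ∀ f g : ℝ → ℝ, MemLp f 2 (wm k) → MemLp g 2 (wm k) →
      ∫ r, (f r + t * g r) * (f r + t * g r) ∂wm k = ∫ r, f r * f r ∂wm k +
        2 * t * ∫ r, f r * g r ∂wm k + t ^ 2 * ∫ r, g r * g r ∂wm k := by
    intro f g hf hg
    have i1 : Integrable (fun r => f r * f r) (wm k) := hf.integrable_mul hf
    have i2 : Integrable (fun r => f r * g r) (wm k) := hf.integrable_mul hg
    have i3 : Integrable (fun r => g r * g r) (wm k) := hg.integrable_mul hg
    have i4 : Integrable (fun r => f r * f r + 2 * t * (f r * g r)) (wm k) :=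
      i1.add (i2.const_mul _)
    rw [← integral_const_mul, ← integral_const_mul, ← integral_add i1 (i2.const_mul _),
      ← integral_add i4 (i3.const_mul _)]
    congr 1; funext r; ring
  have e2 : ∫ r, tail (fun s => p s + t * q s) r * tail (fun s => p s + t * q s) r ∂wm k =
      ∫ r, (tail p r + t * tail q r) * (tail p r + t * tail q r) ∂wm k := by
    refine integral_congr_ae (ae_wm_of_pos fun r hr => ?_)
    simp only [hp.tail_add (hq.smul ht) hr, tail_mul]
  unfold bil
  rw [e2, e _ _ hp.memLp hq.memLp, e _ _ hp.tail_memLp hq.tail_memLp]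
  ring

lemma pow_mul_inter_le {A D : ℝ} (hk : k ≤ 2) (hp : Adm k p) (hq : Adm k q)
    (hA : ∫ s, p s ^ 2 ∂wm k ≤ A) (hD : ∫ s, tail p s ^ 2 ∂wm k ≤ D)
    (hA' : ∫ s, q s ^ 2 ∂wm k ≤ A) (hD' : ∫ s, tail q s ^ 2 ∂wm k ≤ D) {r : ℝ} (hr : 0 < r) :
    r ^ k * (tail p r ^ 2 * tail q r ^ 2) ≤ 2 * (3 * D + A + 2) ^ 4 * (1 + r ^ 2)⁻¹ := by
  have h1 := hp.pow_mul_tail_four_le hk hA hD hr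
  have h2 := hq.pow_mul_tail_four_le hk hA' hD' hr
  have h3 : 0 < r ^ k := pow_pos hr k
  nlinarith [mul_nonneg h3.le (sq_nonneg (tail p r ^ 2 - tail q r ^ 2))]

lemma inter_le {A D : ℝ} (hk : k ≤ 2) (hp : Adm k p) (hq : Adm k q)
    (hA : ∫ s, p s ^ 2 ∂wm k ≤ A) (hD : ∫ s, tail p s ^ 2 ∂wm k ≤ D)
    (hA' : ∫ s, q s ^ 2 ∂wm k ≤ A) (hD' : ∫ s, tail q s ^ 2 ∂wm k ≤ D) :
    inter k p q ≤ ∫ r in Ioi 0, 2 * (3 * D + A + 2) ^ 4 * (1 + r ^ 2)⁻¹ := by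
  unfold inter
  rw [integral_wm]
  exact setIntegral_mono_on (integrable_wm.1 (inter_int hk hp hq))
    (integrable_inv_one_add_sq.const_mul _).integrableOn measurableSet_Ioi
    fun r hr => pow_mul_inter_le hk hp hq hA hD hA' hD' hr

lemma tendsto_inter {P Q : ℕ → ℝ → ℝ} {A D : ℝ} (hk : k ≤ 2) (hP : ∀ n, Adm k (P n))
    (hQ : ∀ n, Adm k (Q n)) (hA : ∀ n, ∫ s, P n s ^ 2 ∂wm k ≤ A)
    (hD : ∀ n, ∫ s, tail (P n) s ^ 2 ∂wm k ≤ D) (hA' : ∀ n, ∫ s, Q n s ^ 2 ∂wm k ≤ A)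
    (hD' : ∀ n, ∫ s, tail (Q n) s ^ 2 ∂wm k ≤ D)
    (hlP : ∀ r, 0 < r → Tendsto (fun n => tail (P n) r) atTop (𝓝 (tail p r)))
    (hlQ : ∀ r, 0 < r → Tendsto (fun n => tail (Q n) r) atTop (𝓝 (tail q r))) :
    Tendsto (fun n => inter k (P n) (Q n)) atTop (𝓝 (inter k p q)) := by
  unfold inter
  simp_rw [integral_wm]
  refine tendsto_integral_of_dominated_convergence
    (fun r => 2 * (3 * D + A + 2) ^ 4 * (1 + r ^ 2)⁻¹)
    (fun n => (integrable_wm.1 (inter_int hk (hP n) (hQ n))).aestronglyMeasurable)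
    (integrable_inv_one_add_sq.const_mul _).integrableOn ?_ ?_
  · intro n
    filter_upwards [ae_restrict_mem measurableSet_Ioi] with r hr
    have : 0 < r ^ k := pow_pos hr k
    rw [Real.norm_of_nonneg (by positivity)]
    exact pow_mul_inter_le hk (hP n) (hQ n) (hA n) (hD n) (hA' n) (hD' n) hr
  · filter_upwards [ae_restrict_mem measurableSet_Ioi] with r hr
    exact (((hlP r hr).pow 2).mul ((hlQ r hr).pow 2)).const_mul _

end

lemma exists_adm_pos {k : ℕ} (hk : k ≤ 2) : ∃ p, Adm k p ∧ 0 < inter k p p := by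
  let p : ℝ → ℝ := (Icc 1 2).indicator 1
  have hm : Measurable p := measurable_one.indicator measurableSet_Icc
  have hp : Adm k p := adm_of_bounded (d := 1) (R := 2) (C := 1) hm
    (fun s => indicator_nonneg (fun _ _ => zero_le_one) s) (fun s hs => indicator_of_notMem hs _)
    (fun s => indicator_le_self' (fun _ _ => zero_le_one) s)
  refine ⟨p, hp, ?_⟩
  by_contra! h
  rw [inter_self] at h
  have h1 := hp.tail_eq_zero h hk one_pos
  have h2 := hp.tail_sub one_pos one_le_two
  have h3 := hp.tail_nonneg 2
  have h4 : ∫ t in (1 : ℝ)..2, p t = 1 := by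
    have : ∫ t in (1 : ℝ)..2, p t = ∫ t in (1 : ℝ)..2, (1 : ℝ) := by
      refine intervalIntegral.integral_congr fun t ht => ?_
      rw [uIcc_of_le one_le_two] at ht
      exact indicator_of_mem ht _
    rw [this]; norm_num
  linarith

/-- The quartic functional attains its maximum under the energy constraint. -/
lemma exists_maximizer {k : ℕ} (hk : k ≤ 2) {a b μ₁ μ₂ β : ℝ} (ha : 0 < a) (hb : 0 < b)
    (hμ₁ : 0 < μ₁) (hμ₂ : 0 < μ₂) (hβ : 0 < β) :
    ∃ p q : ℝ → ℝ, Adm k p ∧ Adm k q ∧ ∃ L : ℝ, 0 < L ∧ quartic k μ₁ μ₂ β p q = L ∧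
      bil k a p p + bil k b q q ≤ 1 ∧ ∀ p' q', Adm k p' → Adm k q' →
        quartic k μ₁ μ₂ β p' q' ≤ L * (bil k a p' p' + bil k b q' q') ^ 2 := by
  set S : Set ℝ := {x | ∃ p q, Adm k p ∧ Adm k q ∧ bil k a p p + bil k b q q ≤ 1 ∧
    quartic k μ₁ μ₂ β p q = x} with hS
  set D := 1 / a + 1 / b with hD
  have hbd : ∀ p q, bil k a p p + bil k b q q ≤ 1 →
      ∫ s, p s ^ 2 ∂wm k ≤ 1 ∧ ∫ s, tail p s ^ 2 ∂wm k ≤ D ∧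
      ∫ s, q s ^ 2 ∂wm k ≤ 1 ∧ ∫ s, tail q s ^ 2 ∂wm k ≤ D := by
    intro p q h
    have h1 := bil_self_nonneg (k := k) ha p
    have h2 := bil_self_nonneg (k := k) hb q
    have h3 : bil k a p p / a ≤ 1 / a := by gcongr; linarith
    have h4 : bil k b q q / b ≤ 1 / b := by gcongr; linarith
    have h5 : 0 < 1 / a := by positivity
    have h6 : 0 < 1 / b := by positivity
    exact ⟨(sq_le_bil ha p).trans (by linarith), (tail_sq_le_bil ha p).trans (by linarith),
      (sq_le_bil hb q).trans (by linarith), (tail_sq_le_bil hb q).trans (by linarith)⟩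
  have hScale : ∀ p q, Adm k p → Adm k q → ∀ ε, 0 < ε → quartic k μ₁ μ₂ β p q /
      (bil k a p p + bil k b q q + ε) ^ 2 ∈ S := by
    intro p q hp hq ε hε
    have h1 := bil_self_nonneg (k := k) ha p
    have h2 := bil_self_nonneg (k := k) hb q
    set E := bil k a p p + bil k b q q with hE
    have hEε : 0 < E + ε := by linarith
    have ht : (√(E + ε))⁻¹ ^ 2 = (E + ε)⁻¹ := by rw [inv_pow, Real.sq_sqrt hEε.le]
    refine ⟨_, _, hp.smul (t := (√(E + ε))⁻¹) (by positivity),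
      hq.smul (t := (√(E + ε))⁻¹) (by positivity), ?_, ?_⟩
    · rw [bil_smul, bil_smul, ht, ← mul_add, ← hE, inv_mul_le_one₀ hEε]; linarith
    · unfold quartic
      simp only [inter_smul, ht]
      field_simp
  have hSb : BddAbove S := by
    refine ⟨(μ₁ + 2 * β + μ₂) * ∫ r in Ioi 0, 2 * (3 * D + 1 + 2) ^ 4 * (1 + r ^ 2)⁻¹, ?_⟩
    rintro x ⟨p, q, hp, hq, hpq, rfl⟩
    obtain ⟨b1, b2, b3, b4⟩ := hbd p q hpq
    have i1 := inter_le hk hp hp b1 b2 b1 b2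
    have i2 := inter_le hk hp hq b1 b2 b3 b4
    have i3 := inter_le hk hq hq b3 b4 b3 b4
    unfold quartic
    rw [add_mul, add_mul]
    gcongr
  obtain ⟨p₀, hp₀, hp₀'⟩ := exists_adm_pos hk
  have hSn : S.Nonempty := ⟨_, hScale p₀ p₀ hp₀ hp₀ 1 one_pos⟩
  set L := sSup S with hL
  have hLpos : 0 < L := by
    refine lt_of_lt_of_le ?_ (le_csSup hSb (hScale p₀ p₀ hp₀ hp₀ 1 one_pos))
    have h1 := bil_self_nonneg (k := k) ha p₀
    have h2 := bil_self_nonneg (k := k) hb p₀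
    unfold quartic
    positivity
  have hmax : ∀ p' q', Adm k p' → Adm k q' →
        quartic k μ₁ μ₂ β p' q' ≤ L * (bil k a p' p' + bil k b q' q') ^ 2 := by
    intro p q hp hq
    have h1 := bil_self_nonneg (k := k) ha p
    have h2 := bil_self_nonneg (k := k) hb q
    set E := bil k a p p + bil k b q q with hE
    have hlim : Tendsto (fun ε => L * (E + ε) ^ 2) (𝓝[>] 0) (𝓝 (L * (E + 0) ^ 2)) :=
      (Continuous.tendsto (by fun_prop) 0).mono_left nhdsWithin_le_nhds
    rw [add_zero] at hlim
    refine ge_of_tendsto hlim ?_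
    filter_upwards [self_mem_nhdsWithin] with ε hε
    have h3 := le_csSup hSb (hScale p q hp hq ε hε)
    rw [div_le_iff₀ (pow_pos (by rw [mem_Ioi] at hε; linarith) 2)] at h3
    exact h3
  obtain ⟨x, -, hx, hxS⟩ := exists_seq_tendsto_sSup hSn hSb
  choose P Q hP hQ hPQ hx' using hxS
  obtain ⟨p, hp, φ, hφ, hlp, hwp⟩ := exists_adm_limit hP (fun n => (hbd _ _ (hPQ n)).1)
    (fun n => (hbd _ _ (hPQ n)).2.1)
  obtain ⟨q, hq, ψ, hψ, hlq, hwq⟩ := exists_adm_limit (fun n => hQ (φ n))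
    (fun n => (hbd _ _ (hPQ (φ n))).2.2.1) (fun n => (hbd _ _ (hPQ (φ n))).2.2.2)
  have hψt := hψ.tendsto_atTop
  have hlp' : ∀ r, 0 < r → Tendsto (fun n => tail (P (φ (ψ n))) r) atTop (𝓝 (tail p r)) :=
    fun r hr => (hlp r hr).comp hψt
  have hwp' : Tendsto (fun n => ∫ s, P (φ (ψ n)) s * p s ∂wm k) atTop
    (𝓝 (∫ s, p s ^ 2 ∂wm k)) := hwp.comp hψt
  have hB := fun n => hbd _ _ (hPQ (φ (ψ n)))
  refine ⟨p, q, hp, hq, L, hLpos, ?_, ?_, hmax⟩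
  · have i1 := tendsto_inter hk (fun n => hP (φ (ψ n))) (fun n => hP (φ (ψ n)))
      (fun n => (hB n).1) (fun n => (hB n).2.1) (fun n => (hB n).1) (fun n => (hB n).2.1) hlp' hlp'
    have i2 := tendsto_inter hk (fun n => hP (φ (ψ n))) (fun n => hQ (φ (ψ n)))
      (fun n => (hB n).1) (fun n => (hB n).2.1) (fun n => (hB n).2.2.1) (fun n => (hB n).2.2.2)
      hlp' hlq
    have i3 := tendsto_inter hk (fun n => hQ (φ (ψ n))) (fun n => hQ (φ (ψ n)))
      (fun n => (hB n).2.2.1) (fun n => (hB n).2.2.2) (fun n => (hB n).2.2.1)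
      (fun n => (hB n).2.2.2) hlq hlq
    have h1 := ((i1.const_mul μ₁).add (i2.const_mul (2 * β))).add (i3.const_mul μ₂)
    have h2 := hx.comp (hφ.tendsto_atTop.comp hψt)
    refine tendsto_nhds_unique h1 (h2.congr fun n => ?_)
    simp only [Function.comp_apply, ← hx' (φ (ψ n))]
    rfl
  · refine le_of_forall_pos_le_add fun ε hε => ?_
    have hsq : ∀ f g : ℝ → ℝ, MemLp f 2 (wm k) → MemLp g 2 (wm k) →
        2 * ∫ s, f s * g s ∂wm k - ∫ s, g s ^ 2 ∂wm k ≤ ∫ s, f s ^ 2 ∂wm k := by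
      intro f g hf hg
      have i2 : Integrable (fun r => f r * g r) (wm k) := hf.integrable_mul hg
      rw [← integral_const_mul, ← integral_sub (i2.const_mul 2) hg.integrable_sq]
      refine integral_mono ((i2.const_mul 2).sub hg.integrable_sq) hf.integrable_sq fun s => ?_
      nlinarith [sq_nonneg (f s - g s)]
    have e1 := hwp'.eventually (lt_mem_nhds (sub_lt_self _ (by positivity : 0 < ε / 4)))
    have e2 := hwq.eventually (lt_mem_nhds (sub_lt_self _ (by positivity : 0 < ε / 4)))
    have hfat := integrable_and_integral_le_of_tendsto (μ := wm k)
      (G := fun n r => a * tail (P (φ (ψ n))) r ^ 2 + b * tail (Q (φ (ψ n))) r ^ 2)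
      (f := fun r => a * tail p r ^ 2 + b * tail q r ^ 2)
      (C := 1 - ∫ s, p s ^ 2 ∂wm k - ∫ s, q s ^ 2 ∂wm k + ε)
      (ae_wm_of_pos fun r hr =>
        (((hlp' r hr).pow 2).const_mul a).add (((hlq r hr).pow 2).const_mul b))
      (fun n => ((hP _).tail_sq_int.const_mul a).add ((hQ _).tail_sq_int.const_mul b))
      (fun n r => by positivity) (by
        filter_upwards [e1, e2] with n h1 h2
        rw [integral_add ((hP _).tail_sq_int.const_mul a) ((hQ _).tail_sq_int.const_mul b),
          integral_const_mul, integral_const_mul]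
        have h3 := hsq _ _ (hP (φ (ψ n))).memLp hp.memLp
        have h4 := hsq _ _ (hQ (φ (ψ n))).memLp hq.memLp
        have h5 := hPQ (φ (ψ n))
        unfold bil at h5
        simp only [← pow_two] at h5
        linarith)
    have h6 := hfat.2
    rw [integral_add (hp.tail_sq_int.const_mul a) (hq.tail_sq_int.const_mul b),
      integral_const_mul, integral_const_mul] at h6
    unfold bil
    simp only [← pow_two]
    linarith

/-- The integral of `u z v²` for the functions with profiles `p`, `π`, `q`. -/
noncomputable def cross (k : ℕ) (p z q : ℝ → ℝ) : ℝ :=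
  ∫ r, tail p r * tail z r * tail q r * tail q r ∂wm k

section
variable {k : ℕ} {p q z y : ℝ → ℝ}

lemma inter_add_smul_ge (hk : k ≤ 2) {t : ℝ} (ht : 0 ≤ t) (hp : Adm k p) (hq : Adm k q)
    (hz : Adm k z) (hy : Adm k y) :
    inter k p q + 2 * t * (cross k p z q + cross k q y p) ≤
      inter k (fun s => p s + t * z s) (fun s => q s + t * y s) := by
  have i0 := inter_int hk hp hq
  have i1 := hp.prod_four_int hk hz hq hq
  have i2 := hq.prod_four_int hk hy hp hp
  unfold cross inter
  have i12 : Integrable (fun r => tail p r * tail z r * tail q r * tail q r +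
      tail q r * tail y r * tail p r * tail p r) (wm k) := i1.add i2
  rw [← integral_add i1 i2, ← integral_const_mul, ← integral_add i0 (i12.const_mul _)]
  refine integral_mono_ae (i0.add (i12.const_mul _))
    (inter_int hk (hp.add (hz.smul ht)) (hq.add (hy.smul ht))) (ae_wm_of_pos fun r hr => ?_)
  simp only [hp.tail_add (hz.smul ht) hr, hq.tail_add (hy.smul ht) hr, tail_mul]
  have e1 := hp.tail_nonneg r
  have e2 := hq.tail_nonneg r
  have e3 := hz.tail_nonneg r
  have e4 := hy.tail_nonneg r
  generalize tail p r = u at *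
  generalize tail q r = v at *
  generalize tail z r = Z at *
  generalize tail y r = Y at *
  have h1 : (u + t * Z) ^ 2 * (v + t * Y) ^ 2 = u ^ 2 * v ^ 2 + 2 * t * (u * Z * v * v + v * Y * u * u)
      + (t ^ 2 * Z ^ 2 * (v + t * Y) ^ 2 + t ^ 2 * Y ^ 2 * (u ^ 2 + 2 * t * u * Z) +
        4 * t ^ 2 * u * Z * v * Y) := by ring
  have h2 : 0 ≤ t ^ 2 * Z ^ 2 * (v + t * Y) ^ 2 + t ^ 2 * Y ^ 2 * (u ^ 2 + 2 * t * u * Z) +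
        4 * t ^ 2 * u * Z * v * Y := by positivity
  linarith

lemma cross_zero_mul (p z q : ℝ → ℝ) : cross k p (fun s => 0 * z s) q = 0 := by
  unfold cross; rw [tail_mul]; simp

lemma bil_zero_mul (a : ℝ) (p z : ℝ → ℝ) : bil k a p (fun s => 0 * z s) = 0 := by
  unfold bil; rw [tail_mul]; simp

lemma cross_self (p q : ℝ → ℝ) : cross k p p q = inter k p q := by
  unfold cross inter; congr 1; funext r; ring

end

/-- Comparison of the first-order terms of `1 + 4 t D ≤ (1 + 2 t B + t² C)²`. -/
lemma le_of_quadratic_perturbation {L D B C : ℝ} (hL : 0 < L) (hB : 0 ≤ B) (hC : 0 ≤ C)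
    (h : ∀ t, 0 < t → L + 4 * t * D ≤ L * (1 + 2 * t * B + t ^ 2 * C) ^ 2) : D ≤ L * B := by
  set K := L * (4 * B ^ 2 + 2 * C + 4 * B * C + C ^ 2) with hK
  have hK0 : 0 ≤ K := by positivity
  by_contra! hlt
  set t := min 1 ((D - L * B) / (K + 1)) with ht
  have hδ : 0 < (D - L * B) / (K + 1) := div_pos (by linarith) (by linarith)
  have ht0 : 0 < t := lt_min one_pos hδ
  have ht1 : t ≤ 1 := min_le_left _ _
  have ht2 : t * (K + 1) ≤ D - L * B := by
    rw [← le_div_iff₀ (by linarith)]; exact min_le_right _ _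
  have h1 := h t ht0
  have h2 : L * (1 + 2 * t * B + t ^ 2 * C) ^ 2 ≤ L + 4 * t * (L * B) + t ^ 2 * K := by
    have h3 : 0 ≤ L * (4 * B * C * (t ^ 2 * (1 - t)) + C ^ 2 * (t ^ 2 * (1 - t ^ 2))) := by
      have : t ^ 2 ≤ 1 := pow_le_one₀ ht0.le ht1
      have h4 : 0 ≤ 1 - t := by linarith
      have h5 : 0 ≤ 1 - t ^ 2 := by linarith
      positivity
    rw [hK]
    nlinarith
  have h6 : t * (4 * (D - L * B)) ≤ t * (t * K) := by nlinarith
  have h7 := le_of_mul_le_mul_left h6 ht0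
  nlinarith

section
variable {k : ℕ} {p q : ℝ → ℝ} {a b μ₁ μ₂ β L : ℝ}

lemma first_order (hk : k ≤ 2) (ha : 0 < a) (hb : 0 < b) (hμ₁ : 0 < μ₁) (hμ₂ : 0 < μ₂)
    (hβ : 0 < β) (hp : Adm k p) (hq : Adm k q) (hL : 0 < L) (hval : quartic k μ₁ μ₂ β p q = L)
    (hE : bil k a p p + bil k b q q ≤ 1) (hmax : ∀ p' q', Adm k p' → Adm k q' →
      quartic k μ₁ μ₂ β p' q' ≤ L * (bil k a p' p' + bil k b q' q') ^ 2)
    {z y : ℝ → ℝ} (hz : Adm k z) (hy : Adm k y) :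
    (μ₁ * cross k p z p + β * cross k p z q) + (μ₂ * cross k q y q + β * cross k q y p) ≤
      L * (bil k a p z + bil k b q y) := by
  refine le_of_quadratic_perturbation (C := bil k a z z + bil k b y y) hL
    (add_nonneg (bil_nonneg ha hp hz) (bil_nonneg hb hq hy))
    (add_nonneg (bil_self_nonneg ha z) (bil_self_nonneg hb y)) fun t ht => ?_
  have h1 := hmax _ _ (hp.add (hz.smul ht.le)) (hq.add (hy.smul ht.le))
  have i1 := inter_add_smul_ge hk ht.le hp hp hz hz
  have i2 := inter_add_smul_ge hk ht.le hp hq hz hy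
  have i3 := inter_add_smul_ge hk ht.le hq hq hy hy
  rw [bil_add_smul ht.le hp hz, bil_add_smul ht.le hq hy] at h1
  have j1 := mul_le_mul_of_nonneg_left i1 hμ₁.le
  have j2 := mul_le_mul_of_nonneg_left i2 hβ.le
  have j3 := mul_le_mul_of_nonneg_left i3 hμ₂.le
  have h2 : L + 4 * t * ((μ₁ * cross k p z p + β * cross k p z q) +
      (μ₂ * cross k q y q + β * cross k q y p)) ≤
      quartic k μ₁ μ₂ β (fun s => p s + t * z s) (fun s => q s + t * y s) := by
    rw [← hval]; unfold quartic; linarith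
  refine (h2.trans h1).trans ?_
  have n1 := bil_nonneg ha hp hz
  have n2 := bil_nonneg hb hq hy
  have n3 := bil_self_nonneg (k := k) ha z
  have n4 := bil_self_nonneg (k := k) hb y
  have n5 := bil_self_nonneg (k := k) ha p
  have n6 := bil_self_nonneg (k := k) hb q
  refine mul_le_mul_of_nonneg_left (pow_le_pow_left₀ (by positivity) ?_ 2) hL.le
  linarith

/-- If `β` exceeds the threshold, a maximizer has a nontrivial first component. -/
lemma exists_tail_ne_zero (ha : 0 < a) (hb : 0 < b) (hμ₁ : 0 < μ₁) (hμ₂ : 0 < μ₂)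
    (hβ : μ₂ < β) (hβ' : μ₂ * a < β * b) (hq : Adm k q) (hL : 0 < L)
    (hval : quartic k μ₁ μ₂ β p q = L) (hE : bil k a p p + bil k b q q ≤ 1)
    (hmax : ∀ p' q', Adm k p' → Adm k q' →
      quartic k μ₁ μ₂ β p' q' ≤ L * (bil k a p' p' + bil k b q' q') ^ 2) :
    ∃ r, 0 < r ∧ tail p r ≠ 0 := by
  by_contra! h0
  have hβ0 : 0 < β := hμ₂.trans hβ
  have hz : ∀ f : ℝ → ℝ, inter k p f = 0 := fun f => by
    refine (integral_congr_ae (ae_wm_of_pos fun r hr => ?_)).trans (integral_zero ℝ ℝ)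
    simp [h0 r hr]
  set I := inter k q q with hI
  have hLI : L = μ₂ * I := by rw [← hval]; unfold quartic; rw [hz, hz]; ring
  have hI0 : 0 < I := by rw [hLI] at hL; exact pos_of_mul_pos_right hL hμ₂.le
  have hQb : bil k b q q ≤ 1 := by linarith [bil_self_nonneg (k := k) ha p]
  have hQb0 := bil_self_nonneg (k := k) hb q
  have hQa0 := bil_self_nonneg (k := k) ha q
  set Qa := bil k a q q with hQa
  have hlt : μ₂ * Qa < β := by
    set θ := max (μ₂ / β) (μ₂ * a / (β * b)) with hθ
    have hθ1 : θ < 1 := max_lt ((div_lt_one hβ0).2 hβ) ((div_lt_one (by positivity)).2 hβ')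
    have hθ2 : μ₂ ≤ θ * β := by rw [← div_le_iff₀ hβ0]; exact le_max_left _ _
    have hθ3 : μ₂ * a ≤ θ * (β * b) := by
      rw [← div_le_iff₀ (by positivity)]; exact le_max_right _ _
    have hθ0 : 0 < θ := lt_of_lt_of_le (by positivity) (le_max_left _ _)
    have h1 : 0 ≤ ∫ r, q r * q r ∂wm k := integral_nonneg fun _ => mul_self_nonneg _
    have h2 : 0 ≤ ∫ r, tail q r * tail q r ∂wm k := integral_nonneg fun _ => mul_self_nonneg _
    have h3 : μ₂ * Qa ≤ θ * β * bil k b q q := by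
      rw [hQa]; unfold bil
      nlinarith [mul_le_mul_of_nonneg_right hθ2 h1, mul_le_mul_of_nonneg_right hθ3 h2]
    have h4 : θ * β * bil k b q q ≤ θ * β := mul_le_of_le_one_right (by positivity) hQb
    have h5 : θ * β < β := mul_lt_of_lt_one_left hβ0 hθ1
    linarith
  set t := √((β - μ₂ * Qa) / (μ₂ * Qa ^ 2 + 1)) with ht
  have hden : 0 < μ₂ * Qa ^ 2 + 1 := by positivity
  have hs0 : 0 < (β - μ₂ * Qa) / (μ₂ * Qa ^ 2 + 1) := div_pos (by linarith) hden
  have ht2 : t ^ 2 * (μ₂ * Qa ^ 2 + 1) = β - μ₂ * Qa := by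
    rw [ht, Real.sq_sqrt hs0.le, div_mul_cancel₀ _ hden.ne']
  have ht0 : 0 < t := Real.sqrt_pos.2 hs0
  have h1 := hmax _ _ (hq.smul ht0.le) hq
  have h2 : quartic k μ₁ μ₂ β (fun s => t * q s) q = (μ₁ * t ^ 4 + 2 * β * t ^ 2 + μ₂) * I := by
    have e1 := inter_smul (k := k) t t q q
    have e2 := inter_smul (k := k) t 1 q q
    simp only [one_mul] at e2
    unfold quartic
    rw [e1, e2]; ring
  have h3 : (bil k a (fun s => t * q s) (fun s => t * q s) + bil k b q q) ^ 2 ≤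
      (t ^ 2 * Qa + 1) ^ 2 := by
    rw [bil_smul]
    exact pow_le_pow_left₀ (by positivity) (by linarith) 2
  have h4 : (μ₁ * t ^ 4 + 2 * β * t ^ 2 + μ₂) * I ≤ μ₂ * (t ^ 2 * Qa + 1) ^ 2 * I := by
    rw [← h2]
    refine h1.trans ((mul_le_mul_of_nonneg_left h3 hL.le).trans (le_of_eq ?_))
    rw [hLI]; ring
  have h5 := le_of_mul_le_mul_right h4 hI0
  have h6 : t ^ 2 * (2 * β) ≤ t ^ 2 * (μ₂ * (2 * Qa + t ^ 2 * Qa ^ 2)) := by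
    have : 0 < μ₁ * t ^ 4 := by positivity
    nlinarith
  have h7 := le_of_mul_le_mul_left h6 (by positivity)
  have h8 : 0 < t ^ 2 := by positivity
  nlinarith

end

/-- The primitive of `ψ` on the half-line vanishing at the origin. -/
noncomputable def flux (ψ : ℝ → ℝ) (s : ℝ) : ℝ := ∫ r in Ioc 0 s, ψ r

lemma flux_eq (ψ : ℝ → ℝ) (s : ℝ) (hs : 0 ≤ s) :
    flux ψ s = ∫ r in (0 : ℝ)..s, (Ioi 0).indicator ψ r := by
  rw [intervalIntegral.integral_of_le hs]
  exact setIntegral_congr_fun measurableSet_Ioc fun r hr => by simp [hr.1]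

lemma intervalIntegrable_indicator {ψ : ℝ → ℝ} (hψ : ∀ s, IntegrableOn ψ (Ioc 0 s)) (r s : ℝ) :
    IntervalIntegrable ((Ioi 0).indicator ψ) volume r s := by
  rw [intervalIntegrable_iff, ← integrable_indicator_iff measurableSet_uIoc, indicator_indicator,
    integrable_indicator_iff (measurableSet_uIoc.inter measurableSet_Ioi)]
  exact (hψ (max r s)).mono_set fun t ht => ⟨ht.2, ht.1.2⟩

lemma continuous_flux {ψ : ℝ → ℝ} (hψ : ∀ s, IntegrableOn ψ (Ioc 0 s)) :
    Continuous (flux ψ) := by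
  have h1 : Continuous fun s => ∫ r in (0 : ℝ)..s, (Ioi 0).indicator ψ r :=
    intervalIntegral.continuous_primitive (intervalIntegrable_indicator hψ) 0
  have h2 : flux ψ = fun s => ∫ r in (0 : ℝ)..(max s 0), (Ioi 0).indicator ψ r := by
    funext s
    rw [← flux_eq ψ _ (le_max_right _ _)]
    unfold flux
    rcases le_total 0 s with h | h
    · rw [max_eq_left h]
    · rw [max_eq_right h, Ioc_eq_empty (not_lt.2 h), Ioc_self]
  rw [h2]
  exact h1.comp (continuous_id.max continuous_const)

lemma lintegral_mul_lintegral_Ioi {φ w : ℝ → ENNReal} (hφ : Measurable φ) (hw : Measurable w) :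
    ∫⁻ r in Ioi 0, φ r * ∫⁻ s in Ioi r, w s = ∫⁻ s in Ioi 0, w s * ∫⁻ r in Ioc 0 s, φ r := by
  let T : Set (ℝ × ℝ) := {x | 0 < x.1 ∧ x.1 < x.2}
  have hT : MeasurableSet T :=
    (measurableSet_lt measurable_const measurable_fst).inter
      (measurableSet_lt measurable_fst measurable_snd)
  let F : ℝ × ℝ → ENNReal := T.indicator fun x => φ x.1 * w x.2
  have hF : Measurable F :=
    ((hφ.comp measurable_fst).mul (hw.comp measurable_snd)).indicator hT
  have h1 : ∫⁻ r in Ioi 0, φ r * ∫⁻ s in Ioi r, w s = ∫⁻ r, ∫⁻ s, F (r, s) := by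
    rw [← lintegral_indicator measurableSet_Ioi]
    refine lintegral_congr fun r => ?_
    by_cases hr : 0 < r
    · rw [indicator_of_mem (show r ∈ Ioi 0 from hr), ← lintegral_const_mul _ hw,
        ← lintegral_indicator measurableSet_Ioi]
      refine lintegral_congr fun s => ?_
      by_cases hs : r < s <;> simp [F, T, indicator, hr, hs]
    · rw [indicator_of_notMem (show r ∉ Ioi 0 from hr)]
      simp [F, T, hr]
  have h2 : ∫⁻ s in Ioi 0, w s * ∫⁻ r in Ioc 0 s, φ r = ∫⁻ s, ∫⁻ r, F (r, s) := by
    rw [← lintegral_indicator measurableSet_Ioi]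
    refine lintegral_congr fun s => ?_
    by_cases hs : 0 < s
    · rw [indicator_of_mem (show s ∈ Ioi 0 from hs), setLIntegral_congr Ioo_ae_eq_Ioc.symm,
        ← lintegral_const_mul _ hφ, ← lintegral_indicator measurableSet_Ioo]
      refine lintegral_congr fun r => ?_
      by_cases hr : 0 < r ∧ r < s
      · simp [F, T, indicator, hr, mul_comm]
      · simp [F, T, indicator, hr]
    · rw [indicator_of_notMem (show s ∉ Ioi 0 from hs)]
      have : ∀ r, F (r, s) = 0 := fun r =>
        indicator_of_notMem (s := T) (fun h : (r, s) ∈ T => hs (h.1.trans h.2)) _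
      simp [this]
  rw [h1, h2]
  exact lintegral_lintegral_swap hF.aemeasurable

/-- Fubini's theorem for the pairing with a tail. -/
lemma integral_mul_tail {k : ℕ} {φ w : ℝ → ℝ} (hφm : Measurable φ) (hφ0 : ∀ r, 0 ≤ φ r)
    (hφ : ∀ s, IntegrableOn (fun r => r ^ k * φ r) (Ioc 0 s)) (hw : Adm k w)
    (hi : Integrable (fun r => φ r * tail w r) (wm k)) :
    IntegrableOn (fun s => w s * flux (fun r => r ^ k * φ r) s) (Ioi 0) ∧
      ∫ r, φ r * tail w r ∂wm k = ∫ s in Ioi 0, w s * flux (fun r => r ^ k * φ r) s := by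
  have hφk : Measurable fun r => r ^ k * φ r := (measurable_id.pow_const k).mul hφm
  have hflux0 : ∀ s, 0 ≤ flux (fun r => r ^ k * φ r) s := fun s =>
    setIntegral_nonneg measurableSet_Ioc fun r hr => mul_nonneg (pow_nonneg hr.1.le k) (hφ0 r)
  have hmain := lintegral_mul_lintegral_Ioi (φ := fun r => ENNReal.ofReal (r ^ k * φ r))
    (w := fun s => ENNReal.ofReal (w s)) (by fun_prop) (hw.meas.ennreal_ofReal)
  have hl : ∫⁻ r in Ioi 0, ENNReal.ofReal (r ^ k * φ r) * ∫⁻ s in Ioi r, ENNReal.ofReal (w s) =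
      ∫⁻ r in Ioi 0, ENNReal.ofReal (r ^ k * (φ r * tail w r)) := by
    refine setLIntegral_congr_fun measurableSet_Ioi fun r hr => ?_
    rw [← ofReal_integral_eq_lintegral_ofReal (hw.int_Ioi r hr) (ae_of_all _ hw.nonneg),
      ← ENNReal.ofReal_mul (mul_nonneg (pow_nonneg (le_of_lt hr) k) (hφ0 r)), mul_assoc]
    rfl
  have hr : ∫⁻ s in Ioi 0, ENNReal.ofReal (w s) * ∫⁻ r in Ioc 0 s, ENNReal.ofReal (r ^ k * φ r) =
      ∫⁻ s in Ioi 0, ENNReal.ofReal (w s * flux (fun r => r ^ k * φ r) s) := by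
    refine setLIntegral_congr_fun measurableSet_Ioi fun s hs => ?_
    rw [← ofReal_integral_eq_lintegral_ofReal (hφ s), ENNReal.ofReal_mul (hw.nonneg s)]
    · rfl
    · filter_upwards [ae_restrict_mem measurableSet_Ioc] with r hr
      exact mul_nonneg (pow_nonneg hr.1.le k) (hφ0 r)
  rw [hl, hr] at hmain
  have hi' := integrable_wm.1 hi
  have hnn : 0 ≤ᵐ[volume.restrict (Ioi 0)] fun r => r ^ k * (φ r * tail w r) := by
    filter_upwards [ae_restrict_mem measurableSet_Ioi] with r hr
    exact mul_nonneg (pow_nonneg (le_of_lt hr) k) (mul_nonneg (hφ0 r) (hw.tail_nonneg r))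
  have hnn2 : ∀ s, 0 ≤ w s * flux (fun r => r ^ k * φ r) s := fun s =>
    mul_nonneg (hw.nonneg s) (hflux0 s)
  have hms : AEStronglyMeasurable (fun s => w s * flux (fun r => r ^ k * φ r) s)
      (volume.restrict (Ioi 0)) :=
    (hw.meas.mul (continuous_flux hφ).measurable).aestronglyMeasurable
  refine ⟨?_, ?_⟩
  · refine (lintegral_ofReal_ne_top_iff_integrable hms (ae_of_all _ hnn2)).1 ?_
    rw [← hmain]
    exact (lintegral_ofReal_ne_top_iff_integrable hi'.aestronglyMeasurable hnn).2 hi'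
  · rw [integral_wm, integral_eq_lintegral_of_nonneg_ae hnn hi'.aestronglyMeasurable, hmain,
      integral_eq_lintegral_of_nonneg_ae (ae_of_all _ hnn2) hms]

section
variable {k : ℕ} {p q φ : ℝ → ℝ} {a b μ₁ μ₂ β L : ℝ}

lemma Adm.mul_tail_int (hp : Adm k p) (hq : Adm k q) :
    Integrable (fun r => tail p r * tail q r) (wm k) :=
  hp.tail_memLp.integrable_mul hq.tail_memLp

/-- The mass balance whose positive part is `L s ^ k p s`. -/
noncomputable def balance (k : ℕ) (K : ℝ) (φ u : ℝ → ℝ) (s : ℝ) : ℝ :=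
  flux (fun r => r ^ k * φ r) s - K * flux (fun r => r ^ k * u r) s

lemma Adm.tail_loc_int (hp : Adm k p) (s : ℝ) :
    IntegrableOn (fun r => r ^ k * tail p r) (Ioc 0 s) := by
  have h1 : IntegrableOn (fun r => r ^ k * tail p r ^ 2) (Ioc 0 s) :=
    (integrable_wm.1 hp.tail_sq_int).mono_set Ioc_subset_Ioi_self
  have h2 : IntegrableOn (fun r : ℝ => r ^ k) (Ioc 0 s) :=
    (Continuous.integrableOn_Icc (by fun_prop)).mono_set Ioc_subset_Icc_self
  refine Integrable.mono' (h2.add h1)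
    ((measurable_id.pow_const k).mul hp.measurable_tail).aestronglyMeasurable ?_
  filter_upwards [ae_restrict_mem measurableSet_Ioc] with r hr
  have h3 : 0 ≤ r ^ k := pow_nonneg hr.1.le k
  have h4 := hp.tail_nonneg r
  rw [Real.norm_of_nonneg (by positivity)]
  simp only [Pi.add_apply]
  nlinarith [mul_nonneg h3 (sq_nonneg (tail p r - 1)), mul_nonneg h3 h4]

lemma continuous_balance {K : ℝ} {u : ℝ → ℝ}
    (hφ : ∀ s, IntegrableOn (fun r => r ^ k * φ r) (Ioc 0 s))
    (hu : ∀ s, IntegrableOn (fun r => r ^ k * u r) (Ioc 0 s)) : Continuous (balance k K φ u) :=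
  (continuous_flux hφ).sub (continuous_const.mul (continuous_flux hu))

/-- The first-order condition in the cone of profiles is an obstacle problem. -/
lemma obstacle_formula (hL : 0 < L) (hp : Adm k p) (hφm : Measurable φ) (hφ0 : ∀ r, 0 ≤ φ r)
    (hφ : ∀ s, IntegrableOn (fun r => r ^ k * φ r) (Ioc 0 s))
    (hφi : ∀ z, Adm k z → Integrable (fun r => φ r * tail z r) (wm k))
    (hle : ∀ z, Adm k z → ∫ r, φ r * tail z r ∂wm k ≤ L * bil k a p z)
    (heq : ∫ r, φ r * tail p r ∂wm k = L * bil k a p p) :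
    ∀ᵐ s ∂(volume.restrict (Ioi 0)),
      L * (s ^ k * p s) = max (balance k (L * a) φ (tail p) s) 0 := by
  have hMc : Continuous (balance k (L * a) φ (tail p)) := continuous_balance hφ hp.tail_loc_int
  set M := balance k (L * a) φ (tail p) with hM
  set H : ℝ → ℝ := fun s => M s - L * (s ^ k * p s) with hH
  have hHm : Measurable H :=
    hMc.measurable.sub (((measurable_id.pow_const k).mul hp.meas).const_mul L)
  have key : ∀ z, Adm k z → IntegrableOn (fun s => z s * H s) (Ioi 0) ∧
      ∫ s in Ioi 0, z s * H s = ∫ r, φ r * tail z r ∂wm k - L * bil k a p z := by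
    intro z hz
    obtain ⟨i1, e1⟩ := integral_mul_tail hφm hφ0 hφ hz (hφi z hz)
    obtain ⟨i2, e2⟩ := integral_mul_tail hp.measurable_tail hp.tail_nonneg hp.tail_loc_int hz
      (hp.mul_tail_int hz)
    have i3 := integrable_wm.1 (hp.memLp.integrable_mul hz.memLp)
    have hz' : (fun s => z s * H s) = fun s => z s * flux (fun r => r ^ k * φ r) s -
        L * a * (z s * flux (fun r => r ^ k * tail p r) s) - L * (s ^ k * (p * z) s) := by
      funext s; simp only [hH, hM, balance, Pi.mul_apply]; ring
    rw [hz']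
    have i12 : IntegrableOn (fun s => z s * flux (fun r => r ^ k * φ r) s -
        L * a * (z s * flux (fun r => r ^ k * tail p r) s)) (Ioi 0) := i1.sub (i2.const_mul _)
    refine ⟨i12.sub (i3.const_mul _), ?_⟩
    rw [integral_sub i12 (i3.const_mul _),
      integral_sub i1 (i2.const_mul _), integral_const_mul, integral_const_mul, ← e1, ← e2,
      ← integral_wm]
    unfold bil
    simp only [Pi.mul_apply]
    ring
  have h1 : ∀ n : ℕ, ∀ᵐ s ∂(volume.restrict (Ioi 0)),
      s ∈ Icc (1 / ((n : ℝ) + 1)) (n + 1) → H s ≤ 0 := by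
    intro n
    set d := 1 / ((n : ℝ) + 1) with hd
    have hd0 : 0 < d := by positivity
    obtain ⟨C, hC⟩ := (isCompact_Icc (a := d) (b := (n : ℝ) + 1)).bddAbove_image hMc.continuousOn
    set z : ℝ → ℝ := (Icc d (n + 1)).indicator fun s => max (H s) 0 with hz
    have hz0 : ∀ s, 0 ≤ z s := fun s => indicator_nonneg (fun _ _ => le_max_right _ _) s
    have hza : Adm k z := by
      refine adm_of_bounded (d := d) (R := n + 1) (C := max C 0)
        ((hHm.max measurable_const).indicator measurableSet_Icc) hz0
        (fun s hs => indicator_of_notMem hs _) fun s => ?_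
      refine indicator_apply_le' (fun hs => max_le_max_right 0 ?_) fun _ => le_max_right _ _
      have h2 : 0 ≤ L * (s ^ k * p s) :=
        mul_nonneg hL.le (mul_nonneg (pow_nonneg (hd0.le.trans hs.1) k) (hp.nonneg s))
      have h3 : M s ≤ C := hC (mem_image_of_mem _ hs)
      simp only [hH]
      linarith
    obtain ⟨i1, e1⟩ := key z hza
    have hzH : ∀ s, 0 ≤ z s * H s := fun s => by
      by_cases hs : s ∈ Icc d ((n : ℝ) + 1)
      · rw [hz, indicator_of_mem hs]
        rcases le_total (H s) 0 with h | h
        · rw [max_eq_right h, zero_mul]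
        · exact mul_nonneg (le_max_right _ _) h
      · rw [hz, indicator_of_notMem hs, zero_mul]
    have h2 : ∫ s in Ioi 0, z s * H s = 0 :=
      le_antisymm (by rw [e1]; linarith [hle z hza]) (integral_nonneg hzH)
    rw [integral_eq_zero_iff_of_nonneg hzH i1] at h2
    filter_upwards [h2] with s hs hsn
    by_contra! hpos
    simp only [hz, indicator_of_mem hsn, max_eq_left hpos.le, Pi.zero_apply] at hs
    exact (mul_pos hpos hpos).ne' hs
  have h2 : ∀ᵐ s ∂(volume.restrict (Ioi 0)), H s ≤ 0 := by
    filter_upwards [ae_all_iff.2 h1, ae_restrict_mem measurableSet_Ioi] with s hs hs0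
    obtain ⟨n, hn⟩ := exists_nat_gt (max s (1 / s))
    have hs0' : 0 < s := hs0
    refine hs n ⟨?_, by linarith [le_max_left s (1 / s)]⟩
    rw [div_le_iff₀ (by positivity), ← div_le_iff₀' hs0']
    linarith [le_max_right s (1 / s)]
  obtain ⟨i1, e1⟩ := key p hp
  have h3 : ∀ᵐ s ∂(volume.restrict (Ioi 0)), p s * H s = 0 := by
    have h4 : ∫ s in Ioi 0, -(p s * H s) = 0 := by rw [integral_neg, e1, heq]; simp
    have i1n : IntegrableOn (fun s => -(p s * H s)) (Ioi 0) := i1.neg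
    rw [integral_eq_zero_iff_of_nonneg_ae ?_ i1n] at h4
    · filter_upwards [h4] with s hs
      simpa using hs
    · filter_upwards [h2] with s hs
      simpa using mul_nonpos_of_nonneg_of_nonpos (hp.nonneg s) hs
  filter_upwards [h2, h3, ae_restrict_mem measurableSet_Ioi] with s h2 h3 hs
  have hn : 0 ≤ L * (s ^ k * p s) :=
    mul_nonneg hL.le (mul_nonneg (pow_nonneg (le_of_lt hs) k) (hp.nonneg s))
  simp only [hH] at h2 h3
  rcases mul_eq_zero.1 h3 with h | h
  · rw [h] at h2 ⊢
    rw [max_eq_right (by simpa using h2)]; simp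
  · rw [max_eq_left] <;> linarith

/-- The reaction term `μ u³ + β u v²` in terms of the profiles. -/
noncomputable def reac (μ β : ℝ) (p q : ℝ → ℝ) (r : ℝ) : ℝ :=
  μ * tail p r ^ 3 + β * tail p r * tail q r ^ 2

lemma reac_nonneg {μ : ℝ} (hμ : 0 ≤ μ) (hβ : 0 ≤ β) (hp : Adm k p) (hq : Adm k q) (r : ℝ) :
    0 ≤ reac μ β p q r := by
  have := hp.tail_nonneg r
  have := hq.tail_nonneg r
  unfold reac; positivity

lemma measurable_reac (μ β : ℝ) (hp : Adm k p) (hq : Adm k q) : Measurable (reac μ β p q) :=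
  ((hp.measurable_tail.pow_const 3).const_mul μ).add
    ((hp.measurable_tail.const_mul β).mul (hq.measurable_tail.pow_const 2))

lemma reac_mul_tail (μ β : ℝ) {z : ℝ → ℝ} (hk : k ≤ 2) (hp : Adm k p) (hq : Adm k q)
    (hz : Adm k z) :
    Integrable (fun r => reac μ β p q r * tail z r) (wm k) ∧
      ∫ r, reac μ β p q r * tail z r ∂wm k = μ * cross k p z p + β * cross k p z q := by
  have i1 := (hp.prod_four_int hk hz hp hp).const_mul μ
  have i2 := (hp.prod_four_int hk hz hq hq).const_mul β
  have e : (fun r => reac μ β p q r * tail z r) = fun r =>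
      μ * (tail p r * tail z r * tail p r * tail p r) +
        β * (tail p r * tail z r * tail q r * tail q r) := by
    funext r; unfold reac; ring
  rw [e]
  refine ⟨i1.add i2, ?_⟩
  rw [integral_add i1 i2, integral_const_mul, integral_const_mul]
  rfl

lemma reac_loc_int {μ : ℝ} (hμ : 0 ≤ μ) (hβ : 0 ≤ β) (hk : k ≤ 2) (hp : Adm k p) (hq : Adm k q)
    (s : ℝ) : IntegrableOn (fun r => r ^ k * reac μ β p q r) (Ioc 0 s) := by
  have h1 : IntegrableOn (fun r => r ^ k * tail p r ^ 4) (Ioc 0 s) :=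
    (integrable_wm.1 (hp.tail_four_int hk)).mono_set Ioc_subset_Ioi_self
  have h3 : IntegrableOn (fun r => r ^ k * tail q r ^ 4) (Ioc 0 s) :=
    (integrable_wm.1 (hq.tail_four_int hk)).mono_set Ioc_subset_Ioi_self
  have h2 : IntegrableOn (fun r : ℝ => r ^ k) (Ioc 0 s) :=
    (Continuous.integrableOn_Icc (by fun_prop)).mono_set Ioc_subset_Icc_self
  refine Integrable.mono' (((h2.add h1).add h3).const_mul (μ + 2 * β))
    ((measurable_id.pow_const k).mul (measurable_reac μ β hp hq)).aestronglyMeasurable ?_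
  filter_upwards [ae_restrict_mem measurableSet_Ioc] with r hr
  have h3 : 0 ≤ r ^ k := pow_nonneg hr.1.le k
  have h4 := hp.tail_nonneg r
  have h5 := reac_nonneg hμ hβ hp hq r
  rw [Real.norm_of_nonneg (by positivity)]
  simp only [Pi.add_apply]
  unfold reac
  generalize tail p r = u at *
  generalize tail q r = v at *
  have e1 : u ^ 3 ≤ 1 + u ^ 4 := by
    nlinarith [sq_nonneg (u ^ 2 - u), sq_nonneg (u - 1), sq_nonneg (u ^ 2 - 1)]
  have e2 : u * v ^ 2 ≤ 2 * (1 + u ^ 4 + v ^ 4) := by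
    nlinarith [sq_nonneg (u ^ 2 - 1), sq_nonneg (u - 1), sq_nonneg (v ^ 2 - u)]
  have e3 : μ * u ^ 3 + β * u * v ^ 2 ≤ (μ + 2 * β) * (1 + u ^ 4 + v ^ 4) := by
    have : 0 ≤ v ^ 4 := by positivity
    nlinarith [mul_le_mul_of_nonneg_left e1 hμ, mul_le_mul_of_nonneg_left e2 hβ,
      mul_nonneg hμ this]
  calc r ^ k * (μ * u ^ 3 + β * u * v ^ 2) ≤ r ^ k * ((μ + 2 * β) * (1 + u ^ 4 + v ^ 4)) :=
        mul_le_mul_of_nonneg_left e3 h3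
    _ = _ := by ring

/-- The Euler-Lagrange system of the maximization problem. -/
lemma euler_lagrange (hk : k ≤ 2) (ha : 0 < a) (hb : 0 < b) (hμ₁ : 0 < μ₁) (hμ₂ : 0 < μ₂)
    (hβ : 0 < β) (hp : Adm k p) (hq : Adm k q) (hL : 0 < L) (hval : quartic k μ₁ μ₂ β p q = L)
    (hE : bil k a p p + bil k b q q ≤ 1) (hmax : ∀ p' q', Adm k p' → Adm k q' →
      quartic k μ₁ μ₂ β p' q' ≤ L * (bil k a p' p' + bil k b q' q') ^ 2) :
    ∀ᵐ s ∂(volume.restrict (Ioi 0)),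
      L * (s ^ k * p s) = max (balance k (L * a) (reac μ₁ β p q) (tail p) s) 0 := by
  have hfo := fun z y hz hy =>
    first_order (z := z) (y := y) hk ha hb hμ₁ hμ₂ hβ hp hq hL hval hE hmax hz hy
  have h1 : ∀ z, Adm k z → μ₁ * cross k p z p + β * cross k p z q ≤ L * bil k a p z := by
    intro z hz
    have := hfo z (fun s => 0 * q s) hz (hq.smul le_rfl)
    simpa only [cross_zero_mul, bil_zero_mul, mul_zero, add_zero, zero_add] using this
  have h2 : ∀ y, Adm k y → μ₂ * cross k q y q + β * cross k q y p ≤ L * bil k b q y := by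
    intro y hy
    have := hfo (fun s => 0 * p s) y (hp.smul le_rfl) hy
    simpa only [cross_zero_mul, bil_zero_mul, mul_zero, add_zero, zero_add] using this
  refine obstacle_formula hL hp (measurable_reac μ₁ β hp hq) (reac_nonneg hμ₁.le hβ.le hp hq)
    (reac_loc_int hμ₁.le hβ.le hk hp hq) (fun z hz => (reac_mul_tail μ₁ β hk hp hq hz).1)
    (fun z hz => by rw [(reac_mul_tail μ₁ β hk hp hq hz).2]; exact h1 z hz) ?_
  rw [(reac_mul_tail μ₁ β hk hp hq hp).2]
  refine le_antisymm (h1 p hp) ?_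
  have h3 := h2 q hq
  rw [cross_self, cross_self, inter_comm k q p] at h3
  rw [cross_self, cross_self]
  unfold quartic at hval
  nlinarith

end

/-- A nonnegative solution `u` of the first-order system `u' = -M⁺ / (L s ^ k)`, `M' = s ^ k u c`
on the half-line, where the potential `c` is decreasing. -/
structure Flow (k : ℕ) (L : ℝ) (c u M : ℝ → ℝ) : Prop where
  pos : 0 < L
  cont : Continuous M
  zero : M 0 = 0
  deriv_M : ∀ s, 0 < s → HasDerivAt M (s ^ k * (u s * c s)) s
  deriv_u : ∀ s, 0 < s → HasDerivAt u (-(max (M s) 0 / (L * s ^ k))) s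
  nonneg : ∀ s, 0 < s → 0 ≤ u s
  lim : Tendsto u atTop (𝓝 0)
  anti : AntitoneOn c (Ioi 0)

lemma hasDerivAt_flux {ψ : ℝ → ℝ} (hψ : ∀ s, IntegrableOn ψ (Ioc 0 s)) (hm : Measurable ψ)
    {s : ℝ} (hs : 0 < s) (hc : ContinuousAt ψ s) : HasDerivAt (flux ψ) (ψ s) s := by
  have hnear : ∀ᶠ r in 𝓝 s, 0 < r := lt_mem_nhds hs
  have h1 : (Ioi 0).indicator ψ =ᶠ[𝓝 s] ψ := hnear.mono fun r hr => indicator_of_mem hr _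
  have h2 := intervalIntegral.integral_hasDerivAt_right (intervalIntegrable_indicator hψ 0 s)
    (hm.indicator measurableSet_Ioi).stronglyMeasurable.stronglyMeasurableAtFilter
    (hc.congr h1.symm)
  rw [h1.eq_of_nhds] at h2
  exact h2.congr_of_eventuallyEq (hnear.mono fun r hr => flux_eq ψ r hr.le)

section
variable {k : ℕ} {p q : ℝ → ℝ} {a μ β L : ℝ}

lemma Adm.tail_eq (hp : Adm k p) {r : ℝ} (hr : 0 < r) :
    tail p r = tail p 1 - ∫ t in (1 : ℝ)..r, p t := by
  rcases le_total r 1 with h | h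
  · rw [intervalIntegral.integral_symm, ← hp.tail_sub hr h]; ring
  · rw [← hp.tail_sub one_pos h]; ring

lemma Adm.tendsto_tail (hp : Adm k p) : Tendsto (tail p) atTop (𝓝 0) := by
  have h1 := (intervalIntegral_tendsto_integral_Ioi 1 (hp.int_Ioi 1 one_pos) tendsto_id).const_sub
    (tail p 1)
  rw [show tail p 1 - ∫ x in Ioi 1, p x = 0 from sub_self _] at h1
  refine h1.congr' ?_
  filter_upwards [eventually_gt_atTop 0] with r hr
  exact (hp.tail_eq hr).symm

lemma Adm.hasDerivAt_tail (hp : Adm k p) {w : ℝ → ℝ} (hw : ContinuousOn w (Ioi 0))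
    (hm : Measurable w) (h : ∀ᵐ s ∂(volume.restrict (Ioi 0)), p s = w s) {s : ℝ} (hs : 0 < s) :
    HasDerivAt (tail p) (-w s) s := by
  have hsub : ∀ r : ℝ, 0 < r → uIcc 1 r ⊆ Ioi 0 := fun r hr t ht =>
    lt_of_lt_of_le (lt_min one_pos hr) ht.1
  have h1 : ∀ r, 0 < r → tail p r = tail p 1 - ∫ t in (1 : ℝ)..r, w t := by
    intro r hr
    rw [hp.tail_eq hr]
    congr 1
    refine intervalIntegral.integral_congr_ae ?_
    filter_upwards [(ae_restrict_iff' measurableSet_Ioi).1 h] with t ht htr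
    exact ht (hsub r hr (uIoc_subset_uIcc htr))
  have h2 := intervalIntegral.integral_hasDerivAt_right
    (hw.mono (hsub s hs)).intervalIntegrable hm.stronglyMeasurable.stronglyMeasurableAtFilter
    (hw.continuousAt (Ioi_mem_nhds hs))
  refine (h2.const_sub (tail p 1)).congr_of_eventuallyEq ?_
  filter_upwards [lt_mem_nhds hs] with r hr using h1 r hr

lemma Adm.continuousOn_tail (hp : Adm k p) : ContinuousOn (tail p) (Ioi 0) := by
  intro s hs
  have hs' : 0 < s := hs
  have hd : 0 < s / 2 := by linarith
  have h1 : Continuous fun r => ∫ t in (s / 2)..r, (Ioi (s / 2)).indicator p t :=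
    intervalIntegral.continuous_primitive (fun x y =>
      ((hp.int_Ioi _ hd).integrable_indicator measurableSet_Ioi).intervalIntegrable) _
  refine ContinuousAt.continuousWithinAt ?_
  refine (continuous_const.sub h1 : Continuous fun r => tail p (s / 2) - _).continuousAt.congr ?_
  filter_upwards [lt_mem_nhds (show s / 2 < s by linarith)] with r hr
  have h2 := hp.tail_sub hd hr.le
  have h3 : ∫ t in (s / 2)..r, (Ioi (s / 2)).indicator p t = ∫ t in (s / 2)..r, p t := by
    rw [intervalIntegral.integral_of_le hr.le, intervalIntegral.integral_of_le hr.le]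
    exact setIntegral_congr_fun measurableSet_Ioc fun t ht => indicator_of_mem ht.1 _
  change tail p (s / 2) - ∫ t in (s / 2)..r, (Ioi (s / 2)).indicator p t = tail p r
  rw [h3]
  linarith

/-- Solutions of the Euler-Lagrange relation solve the first-order system. -/
lemma flow_of_euler_lagrange (hk : k ≤ 2) (hμ : 0 < μ) (hβ : 0 < β) (hL : 0 < L)
    (hp : Adm k p) (hq : Adm k q)
    (h : ∀ᵐ s ∂(volume.restrict (Ioi 0)),
      L * (s ^ k * p s) = max (balance k (L * a) (reac μ β p q) (tail p) s) 0) :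
    Flow k L (fun s => μ * tail p s ^ 2 + β * tail q s ^ 2 - L * a) (tail p)
      (balance k (L * a) (reac μ β p q) (tail p)) where
  pos := hL
  cont := continuous_balance (reac_loc_int hμ.le hβ.le hk hp hq) hp.tail_loc_int
  zero := by simp [balance, flux]
  deriv_M s hs := by
    have c1 := (hp.continuousOn_tail).continuousAt (Ioi_mem_nhds hs)
    have c2 := (hq.continuousOn_tail).continuousAt (Ioi_mem_nhds hs)
    have cr : ContinuousAt (reac μ β p q) s :=
      (continuousAt_const.mul (c1.pow 3)).add ((continuousAt_const.mul c1).mul (c2.pow 2))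
    have cs : ContinuousAt (fun r : ℝ => r ^ k) s := (continuous_pow k).continuousAt
    have h1 := hasDerivAt_flux (reac_loc_int hμ.le hβ.le hk hp hq)
      ((measurable_id.pow_const k).mul (measurable_reac μ β hp hq)) hs (cs.mul cr)
    have h2 := hasDerivAt_flux hp.tail_loc_int
      ((measurable_id.pow_const k).mul hp.measurable_tail) hs (cs.mul c1)
    refine (h1.sub (h2.const_mul (L * a))).congr_deriv ?_
    simp only [reac]
    ring
  deriv_u s hs := by
    have hMc := continuous_balance (K := L * a) (reac_loc_int hμ.le hβ.le hk hp hq) hp.tail_loc_int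
    refine hp.hasDerivAt_tail (w := fun s =>
      max (balance k (L * a) (reac μ β p q) (tail p) s) 0 / (L * s ^ k)) ?_ ?_ ?_ hs
    · refine (hMc.max continuous_const).continuousOn.div (by fun_prop) fun t ht => ?_
      exact (mul_pos hL (pow_pos ht k)).ne'
    · exact (hMc.measurable.max measurable_const).div (by fun_prop)
    · filter_upwards [h, ae_restrict_mem measurableSet_Ioi] with t ht ht0
      have : 0 < t ^ k := pow_pos ht0 k
      rw [← ht]
      field_simp
  nonneg s _ := hp.tail_nonneg s
  lim := hp.tendsto_tail
  anti r hr s hs hrs := by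
    have h1 := pow_le_pow_left₀ (hp.tail_nonneg s) (hp.tail_anti hr hrs) 2
    have h2 := pow_le_pow_left₀ (hq.tail_nonneg s) (hq.tail_anti hr hrs) 2
    simp only
    nlinarith

end

lemma le_of_hasDerivAt_nonneg {f f' : ℝ → ℝ} {x y : ℝ} (hxy : x ≤ y)
    (hc : ContinuousOn f (Icc x y)) (hd : ∀ t ∈ Ioo x y, HasDerivAt f (f' t) t)
    (h0 : ∀ t ∈ Ioo x y, 0 ≤ f' t) : f x ≤ f y := by
  refine monotoneOn_of_deriv_nonneg (convex_Icc x y) hc ?_ ?_ (left_mem_Icc.2 hxy)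
    (right_mem_Icc.2 hxy) hxy
  · rw [interior_Icc]
    exact fun t ht => (hd t ht).differentiableAt.differentiableWithinAt
  · rw [interior_Icc]
    intro t ht
    rw [(hd t ht).deriv]
    exact h0 t ht

namespace Flow
variable {k : ℕ} {L : ℝ} {c u M : ℝ → ℝ}

lemma contAt (h : Flow k L c u M) {s : ℝ} (hs : 0 < s) : ContinuousAt u s :=
  (h.deriv_u s hs).continuousAt

lemma contOn (h : Flow k L c u M) {s : ℝ} (hs : 0 < s) (t : ℝ) : ContinuousOn u (Icc s t) :=
  fun _ hr => (h.contAt (hs.trans_le hr.1)).continuousWithinAt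

lemma anti_u (h : Flow k L c u M) {s t : ℝ} (hs : 0 < s) (hst : s ≤ t) : u t ≤ u s := by
  have := le_of_hasDerivAt_nonneg (f := fun r => -u r) hst (h.contOn hs t).neg
    (fun r hr => (h.deriv_u r (hs.trans hr.1)).neg) fun r hr => by
      have := pow_pos (hs.trans hr.1) k
      have := h.pos
      rw [neg_neg]
      positivity
  linarith

lemma eq_zero_of_neg (h : Flow k L c u M) {s : ℝ} (hs : 0 < s) (hM : M s < 0) : u s = 0 := by
  obtain ⟨t, ht, hts⟩ := exists_hasDerivAt_eq_slope M _ hs h.cont.continuousOn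
    fun x hx => h.deriv_M x hx.1
  have ht0 : 0 < t := ht.1
  have hct : c t ≤ 0 := by
    by_contra! hpos
    have h1 : 0 ≤ t ^ k * (u t * c t) :=
      mul_nonneg (pow_nonneg ht0.le k) (mul_nonneg (h.nonneg t ht0) hpos.le)
    rw [hts, h.zero, sub_zero, sub_zero] at h1
    exact absurd h1 (not_le.2 (div_neg_of_neg_of_pos hM hs))
  have hMr : ∀ r, s ≤ r → M r ≤ M s := fun r hr => by
    have := le_of_hasDerivAt_nonneg (f := fun r => -M r) hr h.cont.neg.continuousOn
      (fun x hx => (h.deriv_M x (hs.trans hx.1)).neg) fun x hx => by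
        have hx0 := hs.trans hx.1
        have h1 : c x ≤ 0 := (h.anti ht0 hx0 (ht.2.trans hx.1).le).trans hct
        have h2 := mul_nonneg (pow_nonneg hx0.le k) (mul_nonneg (h.nonneg x hx0) (neg_nonneg.2 h1))
        linarith
    linarith
  have hur : ∀ r, s ≤ r → u s ≤ u r := fun r hr =>
    le_of_hasDerivAt_nonneg hr (h.contOn hs r) (fun x hx => h.deriv_u x (hs.trans hx.1))
      fun x hx => by rw [max_eq_right ((hMr x hx.1.le).trans hM.le)]; simp
  refine le_antisymm (ge_of_tendsto h.lim ?_) (h.nonneg s hs)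
  filter_upwards [eventually_ge_atTop s] with r hr using hur r hr

/-- The constraint is never active. -/
lemma M_nonneg (h : Flow k L c u M) {s : ℝ} (hs : 0 ≤ s) : 0 ≤ M s := by
  by_contra! hM
  have hcl : IsCompact (Icc 0 s ∩ M ⁻¹' Ici 0) :=
    isCompact_Icc.inter_right (isClosed_Ici.preimage h.cont)
  obtain ⟨t, ⟨ht, htM⟩, hmax⟩ := hcl.exists_isGreatest ⟨0, ⟨le_rfl, hs⟩, h.zero.ge⟩
  have hts : t < s := lt_of_le_of_ne ht.2 fun e => by
    rw [e] at htM; exact absurd hM (not_lt.2 htM)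
  obtain ⟨x, hx, hxs⟩ := exists_hasDerivAt_eq_slope M _ hts h.cont.continuousOn
    fun x hx => h.deriv_M x (ht.1.trans_lt hx.1)
  have hx0 := ht.1.trans_lt hx.1
  have hMx : M x < 0 := by
    by_contra! hge
    exact absurd (hmax ⟨⟨hx0.le, hx.2.le⟩, hge⟩) (not_le.2 hx.1)
  rw [h.eq_zero_of_neg hx0 hMx, zero_mul, mul_zero, eq_div_iff (sub_pos.2 hts).ne', zero_mul] at hxs
  have : 0 ≤ M t := htM
  linarith

lemma deriv_u' (h : Flow k L c u M) {s : ℝ} (hs : 0 < s) :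
    HasDerivAt u (-(M s / (L * s ^ k))) s := by
  have := h.deriv_u s hs
  rwa [max_eq_left (h.M_nonneg hs.le)] at this

/-- Unique continuation: a zero of `u` forces `u` to vanish. -/
lemma eq_zero_of_eq_zero (h : Flow k L c u M) {s : ℝ} (hs : 0 < s) (hu : u s = 0) {r : ℝ}
    (hr : 0 < r) : u r = 0 := by
  rcases le_total s r with hsr | hrs
  · exact le_antisymm (hu ▸ h.anti_u hs hsr) (h.nonneg r hr)
  have hMs : M s = 0 := by
    have hmin : IsLocalMin u s := by
      filter_upwards [lt_mem_nhds hs] with t ht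
      rw [hu]; exact h.nonneg t ht
    have h1 := hmin.hasDerivAt_eq_zero (h.deriv_u' hs)
    rw [neg_eq_zero, div_eq_zero_iff] at h1
    exact h1.resolve_right (mul_pos h.pos (pow_pos hs k)).ne'
  set K := s ^ k * |c s| + 1 / (L * r ^ k) with hK
  have hLr : 0 < L * r ^ k := mul_pos h.pos (pow_pos hr k)
  have h1 := le_of_hasDerivAt_nonneg (f := fun t => (M t + u t) * Real.exp (K * t))
    (f' := fun t => (t ^ k * (u t * c t) + -(M t / (L * t ^ k))) * Real.exp (K * t) +
      (M t + u t) * (Real.exp (K * t) * (K * 1))) hrs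
    ((h.cont.continuousOn.add (h.contOn hr s)).mul (by fun_prop))
    (fun t ht => ((h.deriv_M t (hr.trans ht.1)).add (h.deriv_u' (hr.trans ht.1))).mul
      ((hasDerivAt_id t).const_mul K).exp) fun t ht => by
      have ht0 := hr.trans ht.1
      have hM := h.M_nonneg ht0.le
      have hu := h.nonneg t ht0
      have e1 : c s ≤ c t := h.anti ht0 hs ht.2.le
      have e2 : t ^ k ≤ s ^ k := pow_le_pow_left₀ ht0.le ht.2.le k
      have e3 : M t / (L * t ^ k) ≤ M t * (1 / (L * r ^ k)) := by
        rw [mul_one_div]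
        have := h.pos
        have := ht.1.le
        gcongr
      have e4 : -(s ^ k * |c s|) * u t ≤ t ^ k * (u t * c t) := by
        have : -(t ^ k * |c s|) * u t ≤ t ^ k * (u t * c t) := by
          have : 0 ≤ t ^ k * u t := mul_nonneg (pow_nonneg ht0.le k) hu
          nlinarith [neg_abs_le (c s)]
        have : t ^ k * |c s| * u t ≤ s ^ k * |c s| * u t := by gcongr
        linarith
      have e5 : 0 ≤ s ^ k * |c s| * M t := by positivity
      have e6 : 0 ≤ 1 / (L * r ^ k) * u t := by positivity
      have : 0 ≤ (t ^ k * (u t * c t) + -(M t / (L * t ^ k))) + (M t + u t) * K := by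
        rw [hK]; nlinarith
      have := mul_nonneg this (Real.exp_pos (K * t)).le
      linarith
  simp only [hMs, hu, add_zero, zero_mul] at h1
  have h2 := nonpos_of_mul_nonpos_left h1 (Real.exp_pos _)
  linarith [h.M_nonneg hr.le, h.nonneg r hr]

/-- Exponential decay where the potential is uniformly negative. -/
lemma exp_decay (h : Flow k L c u M) {α s₁ : ℝ} (hs₁ : 1 ≤ s₁)
    (hc : ∀ s, s₁ ≤ s → c s ≤ -(L * α)) {κ : ℝ} (hκ : 0 < κ) (hκα : κ * k + κ ^ 2 ≤ α) :
    ∃ C, ∀ s, s₁ ≤ s → u s ≤ C * Real.exp (-κ * s) := by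
  have hL := h.pos
  set W : ℝ → ℝ := fun t => M t / L + κ * (t ^ k * u t) with hW
  refine ⟨W s₁ * Real.exp (κ * s₁) / κ, fun s hs => ?_⟩
  have hs0 : 0 < s₁ := by linarith
  have h1 := le_of_hasDerivAt_nonneg (f := fun t => -(W t * Real.exp (κ * t)))
    (f' := fun t => -((t ^ k * (u t * c t) / L + κ * (k * t ^ (k - 1) * u t +
        t ^ k * (-(M t / (L * t ^ k))))) * Real.exp (κ * t) +
      W t * (Real.exp (κ * t) * (κ * 1)))) hs
    (((h.cont.div_const L).continuousOn.add (continuousOn_const.mul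
      ((continuous_pow k).continuousOn.mul (h.contOn hs0 s)))).mul (by fun_prop)).neg
    (fun t ht => ((((h.deriv_M t (hs0.trans ht.1)).div_const L).add
      (((hasDerivAt_pow k t).mul (h.deriv_u' (hs0.trans ht.1))).const_mul κ)).mul
      ((hasDerivAt_id t).const_mul κ).exp).neg) fun t ht => by
      have ht0 := hs0.trans ht.1
      have hu := h.nonneg t ht0
      have htk : 0 < t ^ k := pow_pos ht0 k
      have e1 : t ^ k * (-(M t / (L * t ^ k))) = -(M t / L) := by field_simp
      have e2 : k * t ^ (k - 1) ≤ k * t ^ k := by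
        gcongr
        · linarith [ht.1]
        · omega
      have e3 : t ^ k * (u t * c t) / L ≤ -(α * (t ^ k * u t)) := by
        rw [div_le_iff₀ hL]
        nlinarith [mul_le_mul_of_nonneg_left (hc t ht.1.le) (mul_nonneg htk.le hu)]
      have e4 : κ * (k * t ^ (k - 1) * u t) ≤ κ * (k * t ^ k * u t) := by gcongr
      have e5 : (κ * k + κ ^ 2) * (t ^ k * u t) ≤ α * (t ^ k * u t) := by gcongr
      rw [e1]
      have : 0 ≤ -(t ^ k * (u t * c t) / L + κ * (k * t ^ (k - 1) * u t + -(M t / L)) +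
          W t * κ) := by
        simp only [hW]
        nlinarith
      have := mul_nonneg this (Real.exp_pos (κ * t)).le
      linarith
  have h2 : W s * Real.exp (κ * s) ≤ W s₁ * Real.exp (κ * s₁) := by linarith
  have h3 : κ * u s ≤ W s := by
    have hs0' : 0 < s := by linarith
    have e1 : 0 ≤ M s / L := div_nonneg (h.M_nonneg hs0'.le) hL.le
    have e2 : 1 ≤ s ^ k := one_le_pow₀ (by linarith)
    have e3 := h.nonneg s hs0'
    have : κ * u s ≤ κ * (s ^ k * u s) := by
      gcongr; exact le_mul_of_one_le_left e3 e2
    simp only [hW]; linarith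
  have h4 := Real.exp_pos (κ * s)
  rw [neg_mul, Real.exp_neg, ← div_eq_mul_inv, le_div_iff₀ h4, le_div_iff₀ hκ]
  nlinarith

end Flow

lemma exists_continuous_extension {u : ℝ → ℝ} (hc : ∀ s, 0 < s → ContinuousAt u s)
    (ha : AntitoneOn u (Ioi 0)) {B : ℝ} (hB : ∀ s, 0 < s → u s ≤ B) :
    ∃ w : ℝ → ℝ, Continuous w ∧ (∀ s, 0 < s → w s = u s) ∧ ∀ s, s ≤ 0 → u 1 ≤ w s := by
  have hbdd : BddAbove (u '' Ioi 0) := ⟨B, by rintro _ ⟨s, hs, rfl⟩; exact hB s hs⟩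
  set l := sSup (u '' Ioi 0) with hl
  have hlim : Tendsto u (𝓝[>] 0) (𝓝 l) := ha.tendsto_nhdsGT hbdd
  refine ⟨fun s => if 0 < s then u s else l, ?_, fun s hs => if_pos hs, fun s hs => ?_⟩
  · refine continuous_iff_continuousAt.2 fun s => ?_
    rcases lt_trichotomy s 0 with h | rfl | h
    · refine (continuousAt_const (y := l)).congr ?_
      filter_upwards [gt_mem_nhds h] with t ht using (if_neg (not_lt.2 ht.le)).symm
    · refine continuousAt_iff_continuous_left'_right'.2 ⟨?_, ?_⟩
      · refine (continuousWithinAt_const (b := l)).congr (fun t ht => ?_) (by simp)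
        exact if_neg (not_lt.2 (le_of_lt ht))
      · unfold ContinuousWithinAt
        simp only [lt_irrefl, if_false]
        refine hlim.congr' ?_
        filter_upwards [self_mem_nhdsWithin] with t ht using (if_pos ht).symm
    · refine (hc s h).congr ?_
      filter_upwards [lt_mem_nhds h] with t ht using (if_pos ht).symm
  · simp only [if_neg (not_lt.2 hs)]
    exact le_csSup hbdd ⟨1, mem_Ioi.2 one_pos, rfl⟩

lemma mul_sqrt_sqrt_le {k : ℕ} (hk : k ≤ 2) {s : ℝ} (hs : 0 < s) (hs1 : s ≤ 1) :
    s * √√(s ^ k) ≤ s ^ k * (1 / √s) := by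
  obtain ⟨x, hx, hx1, rfl⟩ : ∃ x : ℝ, 0 < x ∧ x ≤ 1 ∧ s = x ^ 2 :=
    ⟨√s, Real.sqrt_pos.2 hs, Real.sqrt_le_one.2 hs1, (Real.sq_sqrt hs.le).symm⟩
  rw [Real.sqrt_sq hx.le, mul_one_div, le_div_iff₀ hx]
  have h1 : √(x ^ 2) = x := Real.sqrt_sq hx.le
  interval_cases k
  · simp only [pow_zero, Real.sqrt_one]; nlinarith
  · rw [pow_one, h1]
    have : √x ≤ 1 := Real.sqrt_le_one.2 hx1
    nlinarith [mul_le_of_le_one_right (sq_nonneg x) this,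
      mul_nonneg (sq_nonneg x) (Real.sqrt_nonneg x)]
  · rw [show √((x ^ 2) ^ 2) = x ^ 2 from Real.sqrt_sq (by positivity), h1]
    nlinarith [pow_pos hx 4]

namespace Flow
variable {k : ℕ} {L : ℝ} {c u M : ℝ → ℝ}

lemma bounded (h : Flow k L c u M) (hk : k ≤ 2) {K : ℝ} (hK : 0 ≤ K)
    (hb : ∀ s, 0 < s → s ≤ 1 → s ^ k * (u s * c s) ≤ K * √√(s ^ k)) {s : ℝ} (hs : 0 < s) :
    u s ≤ u 1 + 2 * (K / L) := by
  have hL := h.pos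
  have hM : ∀ s, 0 < s → s ≤ 1 → M s ≤ K * √√(s ^ k) * s := fun s hs hs1 => by
    have h1 := le_of_hasDerivAt_nonneg (f := fun t => K * √√(s ^ k) * t - M t)
      (f' := fun t => K * √√(s ^ k) * 1 - t ^ k * (u t * c t)) hs.le
      (Continuous.continuousOn ((continuous_const.mul continuous_id).sub h.cont))
      (fun t ht => ((hasDerivAt_id t).const_mul _).sub (h.deriv_M t ht.1)) fun t ht => by
        have h2 := hb t ht.1 (ht.2.le.trans hs1)
        have h3 : √√(t ^ k) ≤ √√(s ^ k) :=
          Real.sqrt_le_sqrt (Real.sqrt_le_sqrt (pow_le_pow_left₀ ht.1.le ht.2.le k))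
        have := mul_le_mul_of_nonneg_left h3 hK
        linarith
    simp only [h.zero, mul_zero, sub_zero] at h1
    linarith
  have hd : ∀ t, 0 < t → t ≤ 1 → M t / (L * t ^ k) ≤ K / L * (1 / √t) := fun t ht ht1 => by
    have htk := pow_pos ht k
    rw [div_le_iff₀ (by positivity)]
    have h1 := mul_le_mul_of_nonneg_left (mul_sqrt_sqrt_le hk ht ht1) hK
    have h2 : K / L * (1 / √t) * (L * t ^ k) = K * (t ^ k * (1 / √t)) := by
      field_simp
    rw [h2]
    linarith [hM t ht ht1]
  have hKL : 0 ≤ K / L := div_nonneg hK hL.le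
  rcases le_total s 1 with h1 | h1
  · have h2 := le_of_hasDerivAt_nonneg (f := fun t => u t + 2 * (K / L) * √t)
      (f' := fun t => -(M t / (L * t ^ k)) + 2 * (K / L) * (1 / (2 * √t))) h1
      ((h.contOn hs 1).add (by fun_prop))
      (fun t ht => (h.deriv_u' (hs.trans ht.1)).add
        ((Real.hasDerivAt_sqrt (hs.trans ht.1).ne').const_mul _)) fun t ht => by
        have h3 := hd t (hs.trans ht.1) ht.2.le
        have h4 : 2 * (K / L) * (1 / (2 * √t)) = K / L * (1 / √t) := by ring
        linarith
    simp only [Real.sqrt_one, mul_one] at h2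
    have := mul_nonneg (mul_nonneg zero_le_two hKL) (Real.sqrt_nonneg s)
    linarith
  · linarith [h.anti_u one_pos h1]

lemma hasDerivAt_average (h : Flow k L c u M) {g : ℝ → ℝ} (hg : Continuous g)
    (hgu : ∀ s, 0 < s → g s = u s * c s) {s : ℝ} (hs : 0 < s) :
    HasDerivAt u (-(s * (1 / L * ∫ t in (0 : ℝ)..1, t ^ k * g (t * s)))) s := by
  have hL := h.pos
  have h1 : ∫ r in (0 : ℝ)..s, r ^ k * g r = M s := by
    rw [intervalIntegral.integral_eq_sub_of_hasDerivAt_of_le hs.le h.cont.continuousOn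
      (fun r hr => ?_) (Continuous.intervalIntegrable (by fun_prop) _ _), h.zero, sub_zero]
    rw [hgu r hr.1]; exact h.deriv_M r hr.1
  have h2 := intervalIntegral.mul_integral_comp_mul_right (a := 0) (b := 1)
    (f := fun r => r ^ k * g r) s
  rw [zero_mul, one_mul, h1] at h2
  have h3 : ∫ t in (0 : ℝ)..1, (t * s) ^ k * g (t * s) =
      s ^ k * ∫ t in (0 : ℝ)..1, t ^ k * g (t * s) := by
    rw [← intervalIntegral.integral_const_mul]
    congr 1; funext t; ring
  rw [h3] at h2
  have hsk := pow_pos hs k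
  convert h.deriv_u' hs using 2
  rw [← h2]
  field_simp

end Flow

section
variable {k : ℕ} {p q : ℝ → ℝ} {a μ β L : ℝ} {M : ℝ → ℝ}

lemma reaction_le (hk : k ≤ 2) (ha : 0 < a) (hμ : 0 < μ) (hβ : 0 < β) (hL : 0 < L)
    (hp : Adm k p) (hq : Adm k q) :
    ∃ K, 0 ≤ K ∧ ∀ s, 0 < s → s ≤ 1 →
      s ^ k * (tail p s * (μ * tail p s ^ 2 + β * tail q s ^ 2 - L * a)) ≤ K * √√(s ^ k) := by
  set A := 3 * (∫ s, tail p s ^ 2 ∂wm k) + (∫ s, p s ^ 2 ∂wm k) + 2 with hA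
  set B := 3 * (∫ s, tail q s ^ 2 ∂wm k) + (∫ s, q s ^ 2 ∂wm k) + 2 with hB
  have hA0 : 0 ≤ A := by
    have h1 : 0 ≤ ∫ s, tail p s ^ 2 ∂wm k := integral_nonneg fun s => sq_nonneg _
    have h2 : 0 ≤ ∫ s, p s ^ 2 ∂wm k := integral_nonneg fun s => sq_nonneg _
    simp only [hA]; positivity
  refine ⟨μ * A ^ 3 + β * (A * B ^ 2), by positivity, fun s hs hs1 => ?_⟩
  have h1 := hp.sqrt_sqrt_mul_tail_le hk le_rfl le_rfl hs hs1
  have h2 := hq.sqrt_sqrt_mul_tail_le hk le_rfl le_rfl hs hs1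
  rw [← hA] at h1
  rw [← hB] at h2
  have hu := hp.tail_nonneg s
  have hv := hq.tail_nonneg s
  generalize tail p s = u at *
  generalize tail q s = v at *
  have he4 : √√(s ^ k) ^ 4 = s ^ k := by
    rw [show (4 : ℕ) = 2 * 2 from rfl, pow_mul, Real.sq_sqrt (Real.sqrt_nonneg _),
      Real.sq_sqrt (pow_nonneg hs.le k)]
  have he : 0 ≤ √√(s ^ k) := Real.sqrt_nonneg _
  generalize √√(s ^ k) = e at *
  rw [← he4]
  have h3 : (e * u) ^ 3 ≤ A ^ 3 := pow_le_pow_left₀ (by positivity) h1 3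
  have h4 : (e * u) * (e * v) ^ 2 ≤ A * B ^ 2 := by gcongr
  calc e ^ 4 * (u * (μ * u ^ 2 + β * v ^ 2 - L * a))
      = (μ * (e * u) ^ 3 + β * ((e * u) * (e * v) ^ 2)) * e - e ^ 4 * u * (L * a) := by ring
    _ ≤ (μ * (e * u) ^ 3 + β * ((e * u) * (e * v) ^ 2)) * e :=
        sub_le_self _ (by positivity)
    _ ≤ _ := by gcongr

lemma exists_regular_profile (hk : k ≤ 2) (ha : 0 < a) (hμ : 0 < μ) (hβ : 0 < β)
    (hp : Adm k p) (hq : Adm k q)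
    (h : Flow k L (fun s => μ * tail p s ^ 2 + β * tail q s ^ 2 - L * a) (tail p) M)
    (hne : ∃ r, 0 < r ∧ tail p r ≠ 0) :
    ∃ w : ℝ → ℝ, Continuous w ∧ (∀ s, 0 < s → w s = tail p s) ∧ (∀ s, 0 < w s) ∧
      ∃ C κ : ℝ, 0 < C ∧ 0 < κ ∧ ∀ s, 0 ≤ s → w s ≤ C * Real.exp (-κ * s) := by
  have hL := h.pos
  obtain ⟨K, hK, hKb⟩ := reaction_le hk ha hμ hβ hL hp hq
  have hpos : ∀ s, 0 < s → 0 < tail p s := fun s hs =>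
    lt_of_le_of_ne (h.nonneg s hs) fun h0 => by
      obtain ⟨r, hr, hne⟩ := hne
      exact hne (h.eq_zero_of_eq_zero hs h0.symm hr)
  obtain ⟨w, hwc, hwe, hw0⟩ := exists_continuous_extension (fun s hs => h.contAt hs)
    (fun r hr s _ hrs => h.anti_u hr hrs) (fun s hs => h.bounded hk hK hKb hs)
  have hwpos : ∀ s, 0 < w s := fun s => by
    rcases le_or_gt s 0 with hs | hs
    · exact (hpos 1 one_pos).trans_le (hw0 s hs)
    · rw [hwe s hs]; exact hpos s hs
  refine ⟨w, hwc, hwe, hwpos, ?_⟩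
  have hlim : Tendsto (fun s => μ * tail p s ^ 2 + β * tail q s ^ 2 - L * a) atTop
      (𝓝 (μ * 0 ^ 2 + β * 0 ^ 2 - L * a)) :=
    (((hp.tendsto_tail.pow 2).const_mul μ).add ((hq.tendsto_tail.pow 2).const_mul β)).sub_const _
  have hev := hlim.eventually (Iic_mem_nhds
    (show μ * 0 ^ 2 + β * 0 ^ 2 - L * a < -(L * (a / 2)) by nlinarith [mul_pos hL ha]))
  obtain ⟨s₀, hs₀⟩ := eventually_atTop.1 hev
  set κ := min 1 (a / 2 / (k + 1)) with hκ
  have hκ0 : 0 < κ := lt_min one_pos (by positivity)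
  have hκ1 : κ ≤ 1 := min_le_left _ _
  have hκ2 : κ * (k + 1) ≤ a / 2 := by
    rw [← le_div_iff₀ (by positivity)]; exact min_le_right _ _
  obtain ⟨C, hC⟩ := h.exp_decay (α := a / 2) (s₁ := max s₀ 1) (le_max_right _ _)
    (fun s hs => hs₀ s ((le_max_left _ _).trans hs)) hκ0 (by nlinarith)
  obtain ⟨B, hB⟩ := (isCompact_Icc (a := (0 : ℝ)) (b := max s₀ 1)).bddAbove_image
    hwc.continuousOn
  set S := max s₀ 1 with hS
  have hS0 : 0 < S := lt_of_lt_of_le one_pos (le_max_right _ _)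
  have hb : ∀ s, 0 ≤ s → w s ≤ max C (B * Real.exp (κ * S)) * Real.exp (-κ * s) := by
    intro s hs
    rcases le_total s S with h1 | h1
    · have hBs : w s ≤ B := hB (mem_image_of_mem _ ⟨hs, h1⟩)
      have hB0 : 0 < B := (hwpos s).trans_le hBs
      calc w s ≤ B * 1 := by linarith
        _ ≤ B * Real.exp (κ * S + -κ * s) := by
            gcongr
            exact Real.one_le_exp (by nlinarith)
        _ = B * Real.exp (κ * S) * Real.exp (-κ * s) := by rw [Real.exp_add]; ring
        _ ≤ _ := by gcongr; exact le_max_right _ _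
    · rw [hwe s (hS0.trans_le h1)]
      exact (hC s h1).trans (by gcongr; exact le_max_left _ _)
  refine ⟨_, κ, ?_, hκ0, hb⟩
  have h0 := (hwpos 0).trans_le (hb 0 le_rfl)
  simpa using h0

lemma hasDerivAt_rescaled
    (h : Flow k L (fun s => μ * tail p s ^ 2 + β * tail q s ^ 2 - L * a) (tail p) M)
    {w z : ℝ → ℝ} (hw : Continuous w) (hz : Continuous z) (hwe : ∀ s, 0 < s → w s = tail p s)
    (hze : ∀ s, 0 < s → z s = tail q s) {s : ℝ} (hs : 0 < s) :
    HasDerivAt (fun s => w s / √L) (-(s * ∫ t in (0 : ℝ)..1, t ^ k * (w (t * s) / √L *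
      (μ * (w (t * s) / √L) ^ 2 + β * (z (t * s) / √L) ^ 2 - a)))) s := by
  have hL := h.pos
  have h1 := h.hasDerivAt_average (g := fun s => w s * (μ * w s ^ 2 + β * z s ^ 2 - L * a))
    (by fun_prop) (fun s hs => by rw [hwe s hs, hze s hs]) hs
  have h2 : HasDerivAt w _ s := h1.congr_of_eventuallyEq
    (by filter_upwards [lt_mem_nhds hs] with t ht using hwe t ht)
  refine (h2.div_const √L).congr_deriv ?_
  rw [neg_div, mul_div_assoc, ← intervalIntegral.integral_const_mul,
    ← intervalIntegral.integral_div]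
  congr 3
  funext t
  have e1 : √L ^ 2 = L := Real.sq_sqrt hL.le
  have e2 : 0 < √L := Real.sqrt_pos.2 hL
  simp only [div_pow, e1]
  field_simp

end

theorem exists_profiles {k : ℕ} (hk : k ≤ 2) {a b μ₁ μ₂ β : ℝ} (ha : 0 < a) (hb : 0 < b)
    (hμ₁ : 0 < μ₁) (hμ₂ : 0 < μ₂) (h₁ : μ₁ < β) (h₁' : μ₁ * b < β * a) (h₂ : μ₂ < β)
    (h₂' : μ₂ * a < β * b) :
    ∃ u v : ℝ → ℝ, Continuous u ∧ Continuous v ∧ (∀ s, 0 < u s) ∧ (∀ s, 0 < v s) ∧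
      (∀ s, 0 < s → HasDerivAt u (-(s * ∫ t in (0 : ℝ)..1, t ^ k * (u (t * s) *
        (μ₁ * u (t * s) ^ 2 + β * v (t * s) ^ 2 - a)))) s) ∧
      (∀ s, 0 < s → HasDerivAt v (-(s * ∫ t in (0 : ℝ)..1, t ^ k * (v (t * s) *
        (μ₂ * v (t * s) ^ 2 + β * u (t * s) ^ 2 - b)))) s) ∧
      ∃ C c : ℝ, 0 < C ∧ 0 < c ∧ ∀ s, 0 ≤ s → u s + v s ≤ C * Real.exp (-c * s) := by
  have hβ : 0 < β := hμ₁.trans h₁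
  obtain ⟨p, q, hp, hq, L, hL, hval, hE, hmax⟩ := exists_maximizer hk ha hb hμ₁ hμ₂ hβ
  have hval' : quartic k μ₂ μ₁ β q p = L := by rw [← quartic_comm, hval]
  have hE' : bil k b q q + bil k a p p ≤ 1 := by linarith
  have hmax' : ∀ p' q', Adm k p' → Adm k q' →
      quartic k μ₂ μ₁ β p' q' ≤ L * (bil k b p' p' + bil k a q' q') ^ 2 := fun p' q' hp' hq' => by
    rw [← quartic_comm, add_comm]; exact hmax q' p' hq' hp'
  have f1 := flow_of_euler_lagrange hk hμ₁ hβ hL hp hq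
    (euler_lagrange hk ha hb hμ₁ hμ₂ hβ hp hq hL hval hE hmax)
  have f2 := flow_of_euler_lagrange hk hμ₂ hβ hL hq hp
    (euler_lagrange hk hb ha hμ₂ hμ₁ hβ hq hp hL hval' hE' hmax')
  obtain ⟨w, hw, hwe, hw0, C, κ, hC, hκ, hCw⟩ := exists_regular_profile hk ha hμ₁ hβ hp hq f1
    (exists_tail_ne_zero ha hb hμ₁ hμ₂ h₂ h₂' hq hL hval hE hmax)
  obtain ⟨z, hz, hze, hz0, C', κ', hC', hκ', hCz⟩ := exists_regular_profile hk hb hμ₂ hβ hq hp f2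
    (exists_tail_ne_zero hb ha hμ₂ hμ₁ h₁ h₁' hp hL hval' hE' hmax')
  have hs : 0 < √L := Real.sqrt_pos.2 hL
  refine ⟨fun s => w s / √L, fun s => z s / √L, hw.div_const _, hz.div_const _,
    fun s => div_pos (hw0 s) hs, fun s => div_pos (hz0 s) hs,
    fun s h0 => hasDerivAt_rescaled f1 hw hz hwe hze h0,
    fun s h0 => hasDerivAt_rescaled f2 hz hw hze hwe h0, (C + C') / √L, min κ κ', by positivity,
    lt_min hκ hκ', fun s h0 => ?_⟩
  have e1 : Real.exp (-κ * s) ≤ Real.exp (-min κ κ' * s) :=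
    Real.exp_le_exp.2 (by nlinarith [min_le_left κ κ'])
  have e2 : Real.exp (-κ' * s) ≤ Real.exp (-min κ κ' * s) :=
    Real.exp_le_exp.2 (by nlinarith [min_le_right κ κ'])
  have e3 := (hCw s h0).trans (mul_le_mul_of_nonneg_left e1 hC.le)
  have e4 := (hCz s h0).trans (mul_le_mul_of_nonneg_left e2 hC'.le)
  rw [← add_div, div_mul_eq_mul_div]
  gcongr
  linarith

/-! ### Radial functions on Euclidean space -/

section

variable {k : ℕ} {g : ℝ → ℝ}

lemma continuous_average (hg : Continuous g) :
    Continuous fun s => ∫ t in (0 : ℝ)..1, t ^ k * g (t * s) :=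
  intervalIntegral.continuous_parametric_intervalIntegral_of_continuous' (by fun_prop) _ _

lemma average_zero : ∫ t in (0 : ℝ)..1, t ^ k * g (t * 0) = g 0 / (k + 1) := by
  simp only [mul_zero]
  rw [intervalIntegral.integral_mul_const, integral_pow]
  simp
  ring

lemma hasDerivAt_average (hg : Continuous g) {s : ℝ} (hs : 0 < s) :
    HasDerivAt (fun s => ∫ t in (0 : ℝ)..1, t ^ k * g (t * s))
      ((g s - (k + 1) * ∫ t in (0 : ℝ)..1, t ^ k * g (t * s)) / s) s := by
  have key : ∀ r : ℝ, 0 < r → ∫ t in (0 : ℝ)..1, t ^ k * g (t * r) =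
      (∫ t in (0 : ℝ)..r, t ^ k * g t) / r ^ (k + 1) := fun r hr => by
    have h2 := intervalIntegral.mul_integral_comp_mul_right (a := 0) (b := 1)
      (f := fun t => t ^ k * g t) r
    have h3 : ∫ t in (0 : ℝ)..1, (t * r) ^ k * g (t * r) =
        r ^ k * ∫ t in (0 : ℝ)..1, t ^ k * g (t * r) := by
      rw [← intervalIntegral.integral_const_mul]
      congr 1; funext t; ring
    rw [zero_mul, one_mul, h3] at h2
    rw [← h2, eq_div_iff (pow_ne_zero _ hr.ne')]
    ring
  have hc : Continuous fun t => t ^ k * g t := by fun_prop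
  have h1 := (hc.integral_hasStrictDerivAt 0 s).hasDerivAt.div (hasDerivAt_pow (k + 1) s)
    (pow_ne_zero _ hs.ne')
  refine (h1.congr_of_eventuallyEq (by
    filter_upwards [lt_mem_nhds hs] with r hr using key r hr)).congr_deriv ?_
  rw [key s hs, Nat.add_sub_cancel]
  push_cast
  field_simp
  ring

variable {E : Type*} [NormedAddCommGroup E] [InnerProductSpace ℝ E]

lemma hasFDerivAt_comp_norm {φ : ℝ → ℝ} {d : ℝ} {x : E} (hx : x ≠ 0)
    (h : HasDerivAt φ d ‖x‖) : HasFDerivAt (fun y : E => φ ‖y‖) ((d / ‖x‖) • innerSL ℝ x) x := by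
  have hn := norm_pos_iff.2 hx
  have h1 := (hasStrictFDerivAt_norm_sq x).hasFDerivAt.sqrt (by positivity)
  simp only [Real.sqrt_sq (norm_nonneg _)] at h1
  refine (h.comp_hasFDerivAt x h1).congr_fderiv ?_
  ext y
  simp
  field_simp

lemma hasFDerivAt_comp_norm_zero {φ : ℝ → ℝ} (h : HasDerivWithinAt φ 0 (Ici 0) 0) :
    HasFDerivAt (fun y : E => φ ‖y‖) (0 : E →L[ℝ] ℝ) 0 := by
  have h1 := hasDerivWithinAt_iff_isLittleO.1 h
  have ht : Tendsto (fun y : E => ‖y‖) (𝓝 0) (𝓝[Ici 0] 0) :=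
    tendsto_nhdsWithin_iff.2 ⟨tendsto_norm_zero, Eventually.of_forall fun y => norm_nonneg y⟩
  rw [hasFDerivAt_iff_isLittleO]
  have h2 := h1.comp_tendsto ht
  simp only [Function.comp_def, sub_zero, smul_zero] at h2
  simpa using h2.of_norm_right

lemma hasFDerivAt_norm_mul_clm_zero {φ : ℝ → ℝ} (hφ : Continuous φ) (l : E →L[ℝ] ℝ) :
    HasFDerivAt (fun y : E => φ ‖y‖ * l y) (φ 0 • l) 0 := by
  rw [hasFDerivAt_iff_isLittleO]
  have h1 : (fun y : E => φ ‖y‖ - φ 0) =o[𝓝 0] fun _ => (1 : ℝ) := by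
    rw [Asymptotics.isLittleO_one_iff]
    have : Tendsto (fun y : E => φ ‖y‖ - φ 0) (𝓝 0) (𝓝 (φ ‖(0 : E)‖ - φ 0)) :=
      (Continuous.tendsto (by fun_prop) _)
    simpa using this
  have h2 := (h1.mul_isBigO (l.isBigO_id (𝓝 0)).norm_right).congr_right fun y => one_mul _
  refine h2.of_norm_right.congr (fun y => ?_) fun y => (sub_zero y).symm
  simp
  ring

end

section

variable {k : ℕ} {g w : ℝ → ℝ}

/-- The logarithmic derivative `s P'(s)` of the weighted average `P` of `g`. -/
noncomputable def averageSlope (k : ℕ) (g : ℝ → ℝ) (s : ℝ) : ℝ :=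
  g s - (k + 1) * ∫ t in (0 : ℝ)..1, t ^ k * g (t * s)

lemma continuous_averageSlope (hg : Continuous g) : Continuous (averageSlope k g) :=
  hg.sub (continuous_const.mul (continuous_average hg))

lemma averageSlope_zero : averageSlope k g 0 = 0 := by
  rw [averageSlope, average_zero]; field_simp; ring

local notation "Eu" => EuclideanSpace ℝ (Fin (k + 1))

/-- The derivative of `x ↦ -P(‖x‖) x i`. -/
noncomputable def gradDeriv (k : ℕ) (g : ℝ → ℝ) (i : Fin (k + 1))
    (x : EuclideanSpace ℝ (Fin (k + 1))) : EuclideanSpace ℝ (Fin (k + 1)) →L[ℝ] ℝ :=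
  -((∫ t in (0 : ℝ)..1, t ^ k * g (t * ‖x‖)) • EuclideanSpace.proj i +
    (x i * averageSlope k g ‖x‖ / ‖x‖ ^ 2) • innerSL ℝ x)

lemma hasFDerivAt_grad (hg : Continuous g) (i : Fin (k + 1)) (x : Eu) :
    HasFDerivAt (fun y : Eu => -((∫ t in (0 : ℝ)..1, t ^ k * g (t * ‖y‖)) * y i))
      (gradDeriv k g i x) x := by
  let l : Eu →L[ℝ] ℝ := EuclideanSpace.proj i
  rcases eq_or_ne x 0 with rfl | hx
  · refine (hasFDerivAt_norm_mul_clm_zero (continuous_average (k := k) hg) l).neg.congr_fderiv ?_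
    ext y
    simp [gradDeriv, l]
  · refine ((hasFDerivAt_comp_norm hx (hasDerivAt_average (k := k) hg (norm_pos_iff.2 hx))).mul
      l.hasFDerivAt).neg.congr_fderiv ?_
    ext y
    have := norm_pos_iff.2 hx
    simp only [gradDeriv, l, averageSlope]
    generalize ∫ t in (0 : ℝ)..1, t ^ k * g (t * ‖x‖) = P
    simp
    field_simp

lemma continuous_gradDeriv (hg : Continuous g) (i : Fin (k + 1)) :
    Continuous (gradDeriv k g i) := by
  have hR := continuous_averageSlope (k := k) hg
  refine (((continuous_average hg).comp continuous_norm).smul continuous_const |>.add ?_).neg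
  rw [continuous_iff_continuousAt]
  intro x
  rcases eq_or_ne x 0 with rfl | hx
  · have hb : ∀ y : Eu, ‖(y i * averageSlope k g ‖y‖ / ‖y‖ ^ 2) • innerSL ℝ y‖ ≤
        |averageSlope k g ‖y‖| := fun y => by
      rw [norm_smul, innerSL_apply_norm, Real.norm_eq_abs, abs_div, abs_mul, abs_of_nonneg
        (sq_nonneg ‖y‖)]
      rcases eq_or_ne y 0 with rfl | hy
      · simp
      have hn := norm_pos_iff.2 hy
      have h1 : |y i| ≤ ‖y‖ := PiLp.norm_apply_le y i
      rw [div_mul_eq_mul_div, div_le_iff₀ (by positivity)]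
      nlinarith [mul_le_mul_of_nonneg_right h1
        (mul_nonneg (abs_nonneg (averageSlope k g ‖y‖)) hn.le)]
    have h0 : Tendsto (fun y : Eu => |averageSlope k g ‖y‖|) (𝓝 0) (𝓝 0) := by
      have : Tendsto (fun y : Eu => |averageSlope k g ‖y‖|) (𝓝 0)
        (𝓝 |averageSlope k g ‖(0 : Eu)‖|) := Continuous.tendsto (by fun_prop) _
      simpa [averageSlope_zero] using this
    rw [ContinuousAt, map_zero, smul_zero]
    exact squeeze_zero_norm hb h0
  · have hn := (norm_pos_iff.2 hx).ne'
    have h1 : ContinuousAt (fun y : Eu => y i * averageSlope k g ‖y‖ / ‖y‖ ^ 2) x :=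
      ContinuousAt.div (Continuous.continuousAt (by fun_prop))
        (Continuous.continuousAt (by fun_prop)) (by positivity)
    exact h1.smul (innerSL ℝ).continuous.continuousAt

lemma hasFDerivAt_radial (hg : Continuous g) (hw : Continuous w)
    (hd : ∀ s, 0 < s → HasDerivAt w (-(s * ∫ t in (0 : ℝ)..1, t ^ k * g (t * s))) s) (x : Eu) :
    HasFDerivAt (fun y : Eu => w ‖y‖)
      (-(∫ t in (0 : ℝ)..1, t ^ k * g (t * ‖x‖)) • innerSL ℝ x) x := by
  rcases eq_or_ne x 0 with rfl | hx
  · rw [map_zero, smul_zero]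
    refine hasFDerivAt_comp_norm_zero ?_
    refine hasDerivWithinAt_Ici_of_tendsto_deriv (s := Ioi 0)
      (fun s hs => (hd s hs).differentiableAt.differentiableWithinAt)
      hw.continuousWithinAt self_mem_nhdsWithin ?_
    have hc : Continuous fun s => -(s * ∫ t in (0 : ℝ)..1, t ^ k * g (t * s)) :=
      (continuous_id.mul (continuous_average hg)).neg
    have h0 := (hc.tendsto 0).mono_left (nhdsWithin_le_nhds (s := Ioi 0))
    rw [zero_mul, neg_zero] at h0
    refine h0.congr' ?_
    filter_upwards [self_mem_nhdsWithin] with s hs using (hd s hs).deriv.symm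
  · have hn := norm_pos_iff.2 hx
    refine (hasFDerivAt_comp_norm hx (hd _ hn)).congr_fderiv ?_
    congr 1
    field_simp

lemma contDiff_radial (hg : Continuous g) (hw : Continuous w)
    (hd : ∀ s, 0 < s → HasDerivAt w (-(s * ∫ t in (0 : ℝ)..1, t ^ k * g (t * s))) s) :
    ContDiff ℝ 2 fun x : Eu => w ‖x‖ := by
  refine (contDiff_succ_iff_hasFDerivAt (n := 1)).2 ⟨_, ?_, hasFDerivAt_radial hg hw hd⟩
  have h1 : ∀ i : Fin (k + 1), ContDiff ℝ 1
      fun y : Eu => -((∫ t in (0 : ℝ)..1, t ^ k * g (t * ‖y‖)) * y i) := fun i =>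
    contDiff_one_iff_hasFDerivAt.2 ⟨_, continuous_gradDeriv hg i, hasFDerivAt_grad hg i⟩
  have h2 : ContDiff ℝ 1 fun y : Eu => ∑ i : Fin (k + 1),
      (-((∫ t in (0 : ℝ)..1, t ^ k * g (t * ‖y‖)) * y i)) •
        (EuclideanSpace.proj i : Eu →L[ℝ] ℝ) :=
    ContDiff.sum fun i _ => (h1 i).smul contDiff_const
  refine (congrArg (ContDiff ℝ 1) (funext fun y => ?_)).mpr h2
  ext z
  simp [PiLp.inner_apply, Finset.mul_sum]
  refine Finset.sum_congr rfl fun i _ => by ring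

lemma laplacian_radial (hg : Continuous g) (hw : Continuous w)
    (hd : ∀ s, 0 < s → HasDerivAt w (-(s * ∫ t in (0 : ℝ)..1, t ^ k * g (t * s))) s) (x : Eu) :
    laplacian (k + 1) (fun y => w ‖y‖) x = -g ‖x‖ := by
  have h1 : ∀ i : Fin (k + 1), (fun y : Eu => fderiv ℝ (fun z : Eu => w ‖z‖) y
      (EuclideanSpace.single i 1)) =
      fun y => -((∫ t in (0 : ℝ)..1, t ^ k * g (t * ‖y‖)) * y i) := fun i => by
    funext y
    rw [(hasFDerivAt_radial hg hw hd y).fderiv]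
    simp [PiLp.inner_apply]
  have h2 : ∀ i : Fin (k + 1), gradDeriv k g i x (EuclideanSpace.single i 1) =
      -(∫ t in (0 : ℝ)..1, t ^ k * g (t * ‖x‖)) - averageSlope k g ‖x‖ / ‖x‖ ^ 2 * x i ^ 2 :=
    fun i => by
      simp [gradDeriv, PiLp.inner_apply]
      ring
  simp only [laplacian, h1, (hasFDerivAt_grad hg _ x).fderiv, h2]
  rw [Finset.sum_sub_distrib, ← Finset.mul_sum, ← EuclideanSpace.real_norm_sq_eq, Finset.sum_const,
    Finset.card_univ, Fintype.card_fin, nsmul_eq_mul]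
  have h3 : averageSlope k g ‖x‖ / ‖x‖ ^ 2 * ‖x‖ ^ 2 = averageSlope k g ‖x‖ := by
    rcases eq_or_ne x 0 with rfl | hx
    · simp [averageSlope_zero]
    · exact div_mul_cancel₀ _ (pow_ne_zero _ (norm_ne_zero_iff.2 hx))
  rw [h3, averageSlope]
  push_cast
  ring

end

lemma tendsto_cocompact_of_le_exp {E : Type*} [NormedAddCommGroup E] [ProperSpace E] {u : E → ℝ}
    {C c : ℝ} (hc : 0 < c) (h0 : ∀ x, 0 ≤ u x) (h : ∀ x, u x ≤ C * Real.exp (-c * ‖x‖)) :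
    Tendsto u (cocompact E) (𝓝 0) := by
  refine squeeze_zero h0 h ?_
  have h1 : Tendsto (fun x : E => -c * ‖x‖) (cocompact E) atBot :=
    (tendsto_norm_cocompact_atTop (E := E)).const_mul_atTop_of_neg (neg_lt_zero.2 hc)
  simpa using (Real.tendsto_exp_atBot.comp h1).const_mul C

lemma lt_of_threshold {a b μ β : ℝ} (ha : 0 < a) (hb : 0 < b) (hμ : 0 < μ)
    (hβ : μ * max (a / b) (b / a) < β) : μ < β ∧ μ * a < β * b ∧ μ * b < β * a := by
  have h1 := (mul_le_mul_of_nonneg_left (le_max_left (a / b) (b / a)) hμ.le).trans_lt hβ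
  have h2 := (mul_le_mul_of_nonneg_left (le_max_right (a / b) (b / a)) hμ.le).trans_lt hβ
  rw [mul_div_assoc', div_lt_iff₀ hb] at h1
  rw [mul_div_assoc', div_lt_iff₀ ha] at h2
  refine ⟨?_, h1, h2⟩
  nlinarith

end RadialNLS


/-- Existence (with exponential decay) of a positive radially symmetric vector
solution of the autonomous coupled Schrödinger system for
`β > max{μ₁,μ₂}·max{a/b, b/a}`. -/
theorem stmt_15 (N : ℕ) (hN1 : 1 ≤ N) (hN3 : N ≤ 3)
    (a b μ₁ μ₂ β : ℝ) (ha : 0 < a) (hb : 0 < b) (hμ₁ : 0 < μ₁) (hμ₂ : 0 < μ₂)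
    (hβ : max μ₁ μ₂ * max (a / b) (b / a) < β) :
    ∃ u v : EuclideanSpace ℝ (Fin N) → ℝ,
      ContDiff ℝ 2 u ∧ ContDiff ℝ 2 v ∧
      (∀ x, 0 < u x) ∧ (∀ x, 0 < v x) ∧
      (∀ x y, ‖x‖ = ‖y‖ → u x = u y) ∧
      (∀ x y, ‖x‖ = ‖y‖ → v x = v y) ∧
      (∀ x, -laplacian N u x + a * u x = μ₁ * u x ^ 3 + β * u x * v x ^ 2) ∧
      (∀ x, -laplacian N v x + b * v x = μ₂ * v x ^ 3 + β * v x * u x ^ 2) ∧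
      Filter.Tendsto u (Filter.cocompact (EuclideanSpace ℝ (Fin N))) (nhds 0) ∧
      Filter.Tendsto v (Filter.cocompact (EuclideanSpace ℝ (Fin N))) (nhds 0) ∧
      ∃ C c : ℝ, 0 < C ∧ 0 < c ∧
        ∀ x, u x + v x ≤ C * Real.exp (-c * ‖x‖) := by
  obtain ⟨k, rfl⟩ : ∃ k, N = k + 1 := ⟨N - 1, by lia⟩
  have hm : 0 < max (a / b) (b / a) := lt_max_of_lt_left (div_pos ha hb)
  obtain ⟨h₁, -, h₁'⟩ := RadialNLS.lt_of_threshold ha hb hμ₁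
    ((mul_le_mul_of_nonneg_right (le_max_left μ₁ μ₂) hm.le).trans_lt hβ)
  obtain ⟨h₂, h₂', -⟩ := RadialNLS.lt_of_threshold ha hb hμ₂
    ((mul_le_mul_of_nonneg_right (le_max_right μ₁ μ₂) hm.le).trans_lt hβ)
  obtain ⟨u, v, hu, hv, hu0, hv0, hdu, hdv, C, c, hC, hc, hle⟩ :=
    RadialNLS.exists_profiles (k := k) (by lia) ha hb hμ₁ hμ₂ h₁ h₁' h₂ h₂'
  have hg₁ : Continuous fun s => u s * (μ₁ * u s ^ 2 + β * v s ^ 2 - a) := by fun_prop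
  have hg₂ : Continuous fun s => v s * (μ₂ * v s ^ 2 + β * u s ^ 2 - b) := by fun_prop
  refine ⟨fun x => u ‖x‖, fun x => v ‖x‖, RadialNLS.contDiff_radial hg₁ hu hdu,
    RadialNLS.contDiff_radial hg₂ hv hdv, fun x => hu0 _, fun x => hv0 _,
    fun x y h => congrArg u h, fun x y h => congrArg v h, fun x => ?_, fun x => ?_,
    RadialNLS.tendsto_cocompact_of_le_exp (C := C) hc (fun x => (hu0 _).le) (fun x => ?_),
    RadialNLS.tendsto_cocompact_of_le_exp (C := C) hc (fun x => (hv0 _).le) (fun x => ?_),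
    C, c, hC, hc, fun x => hle _ (norm_nonneg x)⟩
  · rw [RadialNLS.laplacian_radial hg₁ hu hdu]; ring
  · rw [RadialNLS.laplacian_radial hg₂ hv hdv]; ring
  · linarith [hle _ (norm_nonneg x), hv0 ‖x‖]
  · linarith [hle _ (norm_nonneg x), hu0 ‖x‖]
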